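/- arXiv:1001.4569 — 2 statements merged into one kernel-verified Lean document; each statement's English description precedes it below -/
import Mathlib

section
/- Let (M^n, E, ⟨,⟩, D, φ) with n ≥ 3 be a GCF-manifold and let g = φ*⟨,⟩ be the induced metric on the regular set. Then the symmetric tensor ǧ := Σ_{i,j,a,b} A_{ia} A_{jb} g^{ab} du^i ⊗ du^j (where A is the Schouten tensor of g and (g^{ab}) is the inverse matrix of (g_{ij})) is a conformally flat Riemannian metric on the set R*_M of non-parabolic regular points, and the Schouten tensor of ǧ coincides with A. -/
noncomputable section

namespace Loc

open Matrix

variable {n : ℕ}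

/-- Points of the local coordinate chart `ℝⁿ`. -/
abbrev Pt (n : ℕ) := Fin n → ℝ

/-- `n × n` real matrices. -/
abbrev Mat (n : ℕ) := Matrix (Fin n) (Fin n) ℝ

/-- `i`-th partial derivative of a scalar function on `ℝⁿ`. -/
def pd (i : Fin n) (f : Pt n → ℝ) (p : Pt n) : ℝ :=
  fderiv ℝ f p (Pi.single i 1)

/-- Christoffel symbols `Γ^k_{ij}` of a metric `g` (as a matrix-valued function). -/
def christoffel (g : Pt n → Mat n) (k i j : Fin n) (p : Pt n) : ℝ :=
  (1 / 2) * ∑ l, (g p)⁻¹ k l *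
    (pd i (fun q => g q j l) p + pd j (fun q => g q i l) p - pd l (fun q => g q i j) p)

/-- Curvature tensor `R^l{}_{kij}` of `g`, i.e. `R(∂ᵢ,∂ⱼ)∂ₖ = Σ_l riemann g l i j k • ∂_l`. -/
def riemann (g : Pt n → Mat n) (l i j k : Fin n) (p : Pt n) : ℝ :=
  pd i (christoffel g l j k) p - pd j (christoffel g l i k) p
    + ∑ m, (christoffel g l i m p * christoffel g m j k p
      - christoffel g l j m p * christoffel g m i k p)

/-- Ricci tensor `R_{jk}` of `g`. -/
def ricci (g : Pt n → Mat n) (j k : Fin n) (p : Pt n) : ℝ :=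
  ∑ i, riemann g i i j k p

/-- Scalar curvature `S_g`. -/
def scalarCurv (g : Pt n → Mat n) (p : Pt n) : ℝ :=
  ∑ j, ∑ k, (g p)⁻¹ j k * ricci g j k p

/-- The Schouten tensor `A = (1/(n-2)) (Ric - S_g/(2(n-1)) g)` of `g`. -/
def schouten (g : Pt n → Mat n) (p : Pt n) : Mat n :=
  (1 / (n - 2 : ℝ)) •
    Matrix.of (fun i j => ricci g i j p - scalarCurv g p / (2 * (n - 1 : ℝ)) * g p i j)

/-- `g` is flat (vanishing curvature, hence vanishing sectional curvature) on `s`. -/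
def FlatOn (g : Pt n → Mat n) (s : Set (Pt n)) : Prop :=
  ∀ p ∈ s, ∀ l i j k, riemann g l i j k p = 0

/-- `g` is conformally flat on `s`: around each point of `s` some conformal multiple
`e^{2σ} g` has vanishing curvature. -/
def ConformallyFlatOn (g : Pt n → Mat n) (s : Set (Pt n)) : Prop :=
  ∀ p ∈ s, ∃ V : Set (Pt n), IsOpen V ∧ p ∈ V ∧ V ⊆ s ∧ ∃ σ : Pt n → ℝ,
    ContDiffOn ℝ (⊤ : ℕ∞) σ V ∧ FlatOn (fun q => Real.exp (2 * σ q) • g q) V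

/-- A coherent tangent bundle over a coordinate domain `U ⊆ ℝⁿ`, in the trivialization
`e₁,…,e_n` of the rank-`n` bundle `E`: `h` is the fiber metric `⟨e_a,e_b⟩`, `ω` are the
connection coefficients (`D_{∂ᵢ} e_b = Σ_a (ω i) a b • e_a`) and `φ` is the bundle
homomorphism (`φ(∂_j) = Σ_a φ a j • e_a`). -/
structure CTB (n : ℕ) where
  U : Set (Pt n)
  h : Pt n → Mat n
  ω : Fin n → Pt n → Mat n
  φ : Pt n → Mat n

namespace CTB

/-- `f` is a smooth bundle homomorphism `TM → E` satisfying the coherence condition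
`D_X f(Y) - D_Y f(X) - f([X,Y]) = 0`. -/
def IsCoherentHom (d : CTB n) (f : Pt n → Mat n) : Prop :=
  (∀ a j, ContDiffOn ℝ (⊤ : ℕ∞) (fun p => f p a j) d.U) ∧
  ∀ p ∈ d.U, ∀ a i j,
    pd i (fun q => f q a j) p + ∑ b, d.ω i p a b * f p b j
      = pd j (fun q => f q a i) p + ∑ b, d.ω j p a b * f p b i

/-- The axioms of a coherent tangent bundle: `U` open, `h` a smooth fiber metric,
`ω` a smooth metric connection, and `φ` a coherent smooth bundle homomorphism. -/
def IsCTB (d : CTB n) : Prop :=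
  IsOpen d.U ∧
  (∀ a b, ContDiffOn ℝ (⊤ : ℕ∞) (fun p => d.h p a b) d.U) ∧
  (∀ p ∈ d.U, (d.h p).IsSymm ∧ (d.h p).PosDef) ∧
  (∀ i a b, ContDiffOn ℝ (⊤ : ℕ∞) (fun p => d.ω i p a b) d.U) ∧
  (∀ p ∈ d.U, ∀ i a b,
    pd i (fun q => d.h q a b) p
      = (∑ c, d.ω i p c a * d.h p c b) + ∑ c, d.ω i p c b * d.h p a c) ∧
  d.IsCoherentHom d.φ

/-- The pull-back metric `g = φ*⟨,⟩`, i.e. `g_{ij} = ⟨φ(∂ᵢ), φ(∂ⱼ)⟩`. -/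
def gmet (d : CTB n) : Pt n → Mat n := fun p => (d.φ p)ᵀ * d.h p * d.φ p

/-- The regular set of `φ` (points of `U` where `φ` is injective). -/
def reg (d : CTB n) : Set (Pt n) := {p | p ∈ d.U ∧ (d.φ p).det ≠ 0}

/-- A generalized conformally flat manifold: a coherent tangent bundle with `n ≥ 3`,
dense regular set, and conformally flat pull-back metric on the regular set. -/
def IsGCF (d : CTB n) : Prop :=
  3 ≤ n ∧ d.IsCTB ∧ d.U ⊆ closure d.reg ∧ ConformallyFlatOn d.gmet d.reg

/-- The Schouten tensor of the pull-back metric. -/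
def schoutenT (d : CTB n) : Pt n → Mat n := fun p => schouten d.gmet p

/-- The set `R*` of non-parabolic regular points (where the Schouten tensor is
non-degenerate). -/
def regStar (d : CTB n) : Set (Pt n) := {p | p ∈ d.reg ∧ (d.schoutenT p).det ≠ 0}

/-- The dual metric `ǧ_{ij} = Σ_{a,b} A_{ia} A_{jb} g^{ab}` (in matrix form `A g⁻¹ A`,
using the symmetry of `A` and `g`). -/
def dualMet (d : CTB n) : Pt n → Mat n :=
  fun p => d.schoutenT p * (d.gmet p)⁻¹ * d.schoutenT p

/-- The tensor `Â = Σ g^{ia} A_{aj} ∂ᵢ ⊗ du^j`, i.e. `g⁻¹ A` in matrix form. -/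
def Ahat (d : CTB n) : Pt n → Mat n := fun p => (d.gmet p)⁻¹ * d.schoutenT p

/-- `ψ` is a smooth bundle homomorphism extending `φ ∘ Â` (defined on the regular set)
to all of `U`. -/
def IsDualHom (d : CTB n) (ψ : Pt n → Mat n) : Prop :=
  (∀ a j, ContDiffOn ℝ (⊤ : ℕ∞) (fun p => ψ p a j) d.U) ∧
  ∀ p ∈ d.reg, ψ p = d.φ p * d.Ahat p

/-- An admissible GCF-manifold: `R*` is dense and `φ ∘ Â` extends smoothly to `U`. -/
def IsAdmissible (d : CTB n) : Prop :=
  d.IsGCF ∧ d.U ⊆ closure d.regStar ∧ ∃ ψ, d.IsDualHom ψ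

end CTB

end Loc

open Loc


section
set_option maxSynthPendingDepth 6


theorem frob_bounds {X F : Type*} [NormedAddCommGroup X] [NormedSpace ℝ X]
    [NormedAddCommGroup F] [NormedSpace ℝ F]
    (B : X → F) (V : Set X) (hV : IsOpen V)
    (hB : ContDiffOn ℝ (⊤ : ℕ∞) B V) (p : X) (hp : p ∈ V) :
    ∃ R > 0, ∃ K : ℝ, 0 < K ∧ Metric.ball p R ⊆ V ∧ (∀ y ∈ Metric.ball p R, ‖B y‖ ≤ K) ∧
      (∀ y ∈ Metric.ball p R, ‖fderiv ℝ B y‖ ≤ K) ∧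
      (∀ y ∈ Metric.ball p R, ∀ z ∈ Metric.ball p R,
        ‖B z - B y - fderiv ℝ B y (z - y)‖ ≤ K * ‖z - y‖ ^ 2) := by
  have hBp : ContDiffAt ℝ (⊤ : ℕ∞) B p := hB.contDiffAt (hV.mem_nhds hp)
  have hD : ContDiffAt ℝ 1 (fderiv ℝ B) p := hBp.fderiv_right (by norm_cast)
  obtain ⟨K0, t, ht, hlip⟩ := hD.exists_lipschitzOnWith
  have h1 : ∀ᶠ y in nhds p, ‖B y‖ < ‖B p‖ + 1 :=
    hBp.continuousAt.norm.eventually_lt_const (by linarith)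
  have h2 : ∀ᶠ y in nhds p, ‖fderiv ℝ B y‖ < ‖fderiv ℝ B p‖ + 1 :=
    hD.continuousAt.norm.eventually_lt_const (by linarith)
  obtain ⟨R, hR, hRs⟩ := Metric.eventually_nhds_iff_ball.1
    (h1.and (h2.and ((Filter.eventually_of_mem ht (fun _ h => h)).and (hV.mem_nhds hp))))
  refine ⟨R, hR, max (max (‖B p‖ + 1) (‖fderiv ℝ B p‖ + 1)) K0, ?_, fun y hy => (hRs y hy).2.2.2,
    fun y hy => ?_, fun y hy => ?_, fun y hy z hz => ?_⟩
  · have := norm_nonneg (B p)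
    exact lt_max_of_lt_left (lt_max_of_lt_left (by linarith))
  · exact (hRs y hy).1.le.trans ((le_max_left _ _).trans (le_max_left _ _))
  · exact (hRs y hy).2.1.le.trans ((le_max_right _ _).trans (le_max_left _ _))
  · have hseg : segment ℝ y z ⊆ Metric.ball p R := (convex_ball p R).segment_subset hy hz
    have key := Convex.norm_image_sub_le_of_norm_hasFDerivWithin_le' (f := B) (f' := fderiv ℝ B)
      (s := segment ℝ y z) (φ := fderiv ℝ B y) (C := K0 * ‖z - y‖) (x := y) (y := z)
      (fun w hw => ((hB.contDiffAt (hV.mem_nhds (hRs w (hseg hw)).2.2.2)).differentiableAt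
        (by simp)).hasFDerivAt.hasFDerivWithinAt)
      (fun w hw => by
        have := hlip.norm_sub_le (hRs w (hseg hw)).2.2.1 (hRs y hy).2.2.1
        refine this.trans ?_
        gcongr
        rw [segment_eq_image'] at hw
        obtain ⟨θ, hθ, rfl⟩ := hw
        simp only [add_sub_cancel_left, norm_smul, Real.norm_eq_abs, abs_of_nonneg hθ.1]
        exact mul_le_of_le_one_left (norm_nonneg _) hθ.2)
      (convex_segment y z) (left_mem_segment ℝ y z) (right_mem_segment ℝ y z)
    refine key.trans ?_
    rw [mul_assoc, ← sq]
    gcongr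
    exact le_max_right _ _

theorem frob_ode {E : Type*} [NormedAddCommGroup E] [NormedSpace ℝ E] [CompleteSpace E]
    (C : ℝ → E →L[ℝ] E) (hC : ContinuousOn C (Set.Icc 0 1))
    (hb : ∀ t ∈ Set.Icc (0:ℝ) 1, ‖C t‖ ≤ 1 / 2) (u0 : E) :
    ∃ α : ℝ → E, α 0 = u0 ∧
      (∀ t ∈ Set.Icc (0:ℝ) 1, HasDerivWithinAt α (C t (α t)) (Set.Icc 0 1) t) ∧
      ∀ t ∈ Set.Icc (0:ℝ) 1, ‖α t‖ ≤ ‖u0‖ * Real.exp 1 := by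
  have hPL : IsPicardLindelof (fun t u => C t u) (tmin := 0) (tmax := 1)
      (⟨0, by simp⟩ : Set.Icc (0:ℝ) 1) u0 (‖u0‖₊ + 1) 0 (‖u0‖₊ + 1) 1 := by
    refine ⟨fun t ht => ?_, fun x _ => ?_, fun t ht x hx => ?_, ?_⟩
    · refine LipschitzWith.lipschitzOnWith ?_
      refine (C t).lipschitz.weaken ?_
      rw [← NNReal.coe_le_coe]
      have := hb t ht
      simp only [coe_nnnorm, NNReal.coe_one]; linarith
    · exact hC.clm_apply continuousOn_const
    · have h1 := (C t).le_opNorm x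
      have h2 := hb t ht
      have h3 : ‖x‖ ≤ ‖u0‖ + (‖u0‖ + 1) := by
        have := mem_closedBall_iff_norm.1 hx
        have h4 := norm_le_norm_add_norm_sub' x u0
        simp at this
        linarith
      have h5 : ‖C t‖ * ‖x‖ ≤ 1 / 2 * (‖u0‖ + (‖u0‖ + 1)) := by gcongr
      simp
      linarith [norm_nonneg u0]
    · simp
  obtain ⟨α, h0, hα⟩ := hPL.exists_eq_forall_mem_Icc_hasDerivWithinAt₀
  refine ⟨α, h0, hα, fun t ht => ?_⟩
  have := norm_le_gronwallBound_of_norm_deriv_right_le (f := α) (f' := fun t => C t (α t))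
    (δ := ‖u0‖) (K := 1) (ε := 0) (a := 0) (b := 1)
    (fun t ht => (hα t ht).continuousWithinAt)
    (fun t ht => (hα t ⟨ht.1, ht.2.le⟩).mono_of_mem_nhdsWithin
      (Icc_mem_nhdsGE_of_mem ht)) (by simpa using (congrArg norm h0).le)
    (fun t ht => by
      have h1 := (C t).le_opNorm (α t)
      have h2 := hb t ⟨ht.1, ht.2.le⟩
      have := norm_nonneg (α t)
      nlinarith) t ht
  refine this.trans ?_
  rw [gronwallBound_ε0]
  gcongr
  simpa using ht.2

theorem frob_line {X F : Type*} [NormedAddCommGroup X] [NormedSpace ℝ X]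
    [NormedAddCommGroup F] [NormedSpace ℝ F] (B : X → F) (B' : X →L[ℝ] F) (p v : X) (t : ℝ)
    (h : HasFDerivAt B B' (p + t • v)) : HasDerivAt (fun t : ℝ => B (p + t • v)) (B' v) t := by
  have h2 : HasDerivAt (fun t : ℝ => p + t • v) v t := by
    simpa using ((hasDerivAt_id t).smul_const v).const_add p
  exact h.comp_hasDerivAt t h2

theorem frob_opb {X F : Type*} [NormedAddCommGroup X] [NormedSpace ℝ X]
    [NormedAddCommGroup F] [NormedSpace ℝ F] (D : X →L[ℝ] F) {x : X} {a b : ℝ}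
    (h : ‖D‖ ≤ a) (h' : ‖x‖ ≤ b) : ‖D x‖ ≤ a * b := D.le_of_opNorm_le_of_le h h'

theorem frob_est {X E : Type*} [NormedAddCommGroup X] [NormedSpace ℝ X]
    [NormedAddCommGroup E] [NormedSpace ℝ E] (B0 B1 : X →L[ℝ] E →L[ℝ] E)
    (D : X →L[ℝ] E →L[ℝ] E) (w0 w1 : E) (v h : X) (t K M : ℝ)
    (ht : t ∈ Set.Icc (0:ℝ) 1) (hK : 0 < K) (hM0 : 0 ≤ M) (hv1 : ‖v‖ ≤ 1) (hh : ‖h‖ ≤ 2)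
    (A0 : ‖B0‖ ≤ K) (A1 : ‖D‖ ≤ K * ‖h‖) (A2 : ‖B1 - B0 - (t • D)‖ ≤ K * ‖t • h‖ ^ 2)
    (A3 : ‖w0‖ ≤ M) (A4 : ‖w1‖ ≤ M) :
    ‖B1 (v + h) w1 - B0 v w0 - (t • (D v w0 + B0 v (B0 h w0)) + B0 h w0)‖
      ≤ 5 * K * ‖w1 - w0 - t • B0 h w0‖ + M * (K + K ^ 2 + 3 * K + K ^ 2) * ‖h‖ ^ 2 := by
  set η := w1 - w0 - t • B0 h w0 with hη
  have hth : ‖t • h‖ ≤ ‖h‖ := by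
    rw [norm_smul, Real.norm_eq_abs, abs_of_nonneg ht.1]
    exact mul_le_of_le_one_left (norm_nonneg h) ht.2
  have A2' : ‖B1 - B0 - (t • D)‖ ≤ K * ‖h‖ ^ 2 := A2.trans (by gcongr)
  have hDh : ‖(t • D)‖ ≤ K * ‖h‖ := by
    rw [norm_smul, Real.norm_eq_abs, abs_of_nonneg ht.1]
    exact (mul_le_of_le_one_left (norm_nonneg _) ht.2).trans A1
  have A5 : ‖B1 - B0‖ ≤ 3 * K * ‖h‖ := by
    have : B1 - B0 = (B1 - B0 - (t • D)) + (t • D) := by abel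
    rw [this]
    refine (norm_add_le _ _).trans ?_
    nlinarith [norm_nonneg h, mul_nonneg hK.le (norm_nonneg h)]
  have hdif : w1 - w0 = η + t • B0 h w0 := by rw [hη]; abel
  have A6 : ‖w1 - w0‖ ≤ ‖η‖ + K * ‖h‖ * M := by
    rw [hdif]
    refine (norm_add_le _ _).trans ?_
    gcongr
    rw [norm_smul, Real.norm_eq_abs, abs_of_nonneg ht.1]
    refine (mul_le_of_le_one_left (norm_nonneg _) ht.2).trans ?_
    refine (B0 h).le_of_opNorm_le_of_le (B0.le_of_opNorm_le A0 h) A3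
  have e : B1 (v + h) w1 - B0 v w0 - (t • (D v w0 + B0 v (B0 h w0)) + B0 h w0)
    = B0 v η + (B1 - B0 - (t • D)) v w1 + (t • D) v (w1 - w0) + (B1 - B0) h w1
      + B0 h (w1 - w0) := by
    rw [hη]
    simp only [map_add, map_sub, map_smul, _root_.add_apply,
      _root_.sub_apply, _root_.smul_apply, smul_add]
    abel
  rw [e]
  have T1 : ‖B0 v η‖ ≤ K * 1 * ‖η‖ :=
    (B0 v).le_of_opNorm_le_of_le (B0.le_of_opNorm_le_of_le A0 hv1) le_rfl
  have T2 : ‖(B1 - B0 - (t • D)) v w1‖ ≤ K * ‖h‖ ^ 2 * 1 * M :=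
    ContinuousLinearMap.le_of_opNorm_le_of_le _
      (ContinuousLinearMap.le_of_opNorm_le_of_le _ A2' hv1) A4
  have T3 : ‖(t • D) v (w1 - w0)‖ ≤ K * ‖h‖ * 1 * (‖η‖ + K * ‖h‖ * M) :=
    ContinuousLinearMap.le_of_opNorm_le_of_le _
      (ContinuousLinearMap.le_of_opNorm_le_of_le _ hDh hv1) A6
  have T4 : ‖(B1 - B0) h w1‖ ≤ 3 * K * ‖h‖ * ‖h‖ * M :=
    ContinuousLinearMap.le_of_opNorm_le_of_le _
      (ContinuousLinearMap.le_of_opNorm_le_of_le _ A5 le_rfl) A4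
  have T5 : ‖B0 h (w1 - w0)‖ ≤ K * ‖h‖ * (‖η‖ + K * ‖h‖ * M) :=
    ContinuousLinearMap.le_of_opNorm_le_of_le _
      (ContinuousLinearMap.le_of_opNorm_le_of_le _ A0 le_rfl) A6
  have T := norm_add_le_of_le (norm_add_le_of_le (norm_add_le_of_le (norm_add_le_of_le
    T1 T2) T3) T4) T5
  refine T.trans ?_
  have := mul_le_mul_of_nonneg_left hh (mul_nonneg hK.le (norm_nonneg η))
  nlinarith

theorem frob {X E : Type*} [NormedAddCommGroup X] [NormedSpace ℝ X]
    [NormedAddCommGroup E] [NormedSpace ℝ E] [CompleteSpace E]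
    (B : X → X →L[ℝ] E →L[ℝ] E) (V : Set X) (hV : IsOpen V)
    (hB : ContDiffOn ℝ (⊤ : ℕ∞) B V) (p : X) (hp : p ∈ V)
    (hintg : ∀ x ∈ V, ∀ h k u, fderiv ℝ B x h k u + B x k (B x h u)
      = fderiv ℝ B x k h u + B x h (B x k u)) :
    ∃ r > 0, Metric.ball p r ⊆ V ∧ ∀ u0 : E, ∃ u : X → E, u p = u0 ∧
      ∀ x ∈ Metric.ball p r, HasFDerivAt u ((B x).flip (u x)) x := by
  obtain ⟨R, hR, K, hK, hRV, hb0, hb1, hb2⟩ := frob_bounds B V hV hB p hp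
  set r : ℝ := min R (min 1 (1 / (2 * K))) with hr
  have hr0 : 0 < r := by positivity
  have hrR : r ≤ R := min_le_left _ _
  have hr1 : r ≤ 1 := (min_le_right _ _).trans (min_le_left _ _)
  have hrK : K * r ≤ 1 / 2 := by
    have : r ≤ 1 / (2 * K) := (min_le_right _ _).trans (min_le_right _ _)
    calc K * r ≤ K * (1 / (2 * K)) := by gcongr
      _ = 1 / 2 := by field_simp
  have hmem : ∀ v : X, ‖v‖ < r → ∀ t ∈ Set.Icc (0:ℝ) 1, p + t • v ∈ Metric.ball p R := by
    intro v hv t ht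
    rw [mem_ball_iff_norm, add_sub_cancel_left, norm_smul, Real.norm_eq_abs, abs_of_nonneg ht.1]
    have := mul_le_of_le_one_left (norm_nonneg v) ht.2
    linarith
  refine ⟨r, hr0, (Metric.ball_subset_ball hrR).trans hRV, fun u0 => ?_⟩
  have hdB : ∀ y ∈ Metric.ball p R, HasFDerivAt B (fderiv ℝ B y) y := fun y hy =>
    ((hB.contDiffAt (hV.mem_nhds (hRV hy))).differentiableAt (by simp)).hasFDerivAt
  have hex : ∀ v : X, ∃ α : ℝ → E, ‖v‖ < r → α 0 = u0 ∧
      (∀ t ∈ Set.Icc (0:ℝ) 1, HasDerivWithinAt α (B (p + t • v) v (α t)) (Set.Icc 0 1) t) ∧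
      ∀ t ∈ Set.Icc (0:ℝ) 1, ‖α t‖ ≤ ‖u0‖ * Real.exp 1 := by
    intro v
    by_cases hv : ‖v‖ < r
    · obtain ⟨α, h⟩ := frob_ode (fun t => B (p + t • v) v)
        (fun t ht => by
          have h1 := frob_line B _ p v t (hdB _ (hmem v hv t ht))
          exact (h1.continuousAt.clm_apply continuousAt_const).continuousWithinAt)
        (fun t ht => by
          refine ((B (p + t • v)).le_opNorm v).trans ?_
          have h1 := hb0 _ (hmem v hv t ht)
          calc ‖B (p + t • v)‖ * ‖v‖ ≤ K * r := by gcongr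
            _ ≤ 1 / 2 := hrK) u0
      exact ⟨α, fun _ => h⟩
    · exact ⟨0, fun h => absurd h hv⟩
  choose α hα using hex
  set M : ℝ := ‖u0‖ * Real.exp 1 with hM
  have hM0 : 0 ≤ M := by positivity
  refine ⟨fun x => α (x - p) 1, ?_, ?_⟩
  · obtain ⟨h0, h1, -⟩ := hα 0 (by simpa using hr0)
    have := constant_of_has_deriv_right_zero (f := α 0) (a := 0) (b := 1)
      (fun t ht => (h1 t ht).continuousWithinAt)
      (fun t ht => by
        have := (h1 t ⟨ht.1, ht.2.le⟩).mono_of_mem_nhdsWithin (Icc_mem_nhdsGE_of_mem ht)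
        simpa using this) 1 (by simp)
    simpa [h0] using this
  · intro x hx
    set v := x - p with hv
    have hvr : ‖v‖ < r := mem_ball_iff_norm.1 hx
    have hpv : x = p + v := by simp [hv]
    set Cc : ℝ := M * (K + K ^ 2 + 3 * K + K ^ 2) with hCc
    have hest : ∀ h : X, ‖v + h‖ < r →
        ‖α (v + h) 1 - α v 1 - B x h (α v 1)‖ ≤ gronwallBound 0 (5 * K) Cc 1 * ‖h‖ ^ 2 := by
      intro h hvh
      obtain ⟨a0, a1, a2⟩ := hα v hvr
      obtain ⟨b0, b1, b2⟩ := hα (v + h) hvh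
      have hh : ‖h‖ ≤ 2 := by
        have : ‖h‖ ≤ ‖v + h‖ + ‖v‖ := by
          simpa using norm_sub_le (v + h) v
        linarith
      have hv1 : ‖v‖ ≤ 1 := by linarith
      have hder : ∀ t ∈ Set.Icc (0:ℝ) 1, HasDerivWithinAt
          (fun t => α (v + h) t - α v t - t • B (p + t • v) h (α v t))
          (B (p + t • (v + h)) (v + h) (α (v + h) t) - B (p + t • v) v (α v t)
            - (t • (fderiv ℝ B (p + t • v) v h (α v t)
                + B (p + t • v) h (B (p + t • v) v (α v t)))
              + B (p + t • v) h (α v t))) (Set.Icc 0 1) t := by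
        intro t ht
        have e1 : HasDerivAt (fun t : ℝ => B (p + t • v)) (fderiv ℝ B (p + t • v) v) t :=
          frob_line B _ p v t (hdB _ (hmem v hvr t ht))
        have e2 : HasDerivAt (fun t : ℝ => B (p + t • v) h) (fderiv ℝ B (p + t • v) v h) t := by
          simpa using e1.clm_apply (hasDerivAt_const t h)
        have e3 := e2.hasDerivWithinAt.clm_apply (a1 t ht)
        have e4 := (hasDerivAt_id t).hasDerivWithinAt.smul e3
        have e5 := ((b1 t ht).sub (a1 t ht)).sub e4
        refine e5.congr_deriv ?_
        simp
      have := norm_le_gronwallBound_of_norm_deriv_right_le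
        (δ := 0) (K := 5 * K) (ε := Cc * ‖h‖ ^ 2) (a := 0) (b := 1)
        (fun t ht => (hder t ht).continuousWithinAt)
        (fun t ht => (hder t ⟨ht.1, ht.2.le⟩).mono_of_mem_nhdsWithin
          (Icc_mem_nhdsGE_of_mem ht)) (by simp [a0, b0])
        (fun t ht' => by
          have ht : t ∈ Set.Icc (0:ℝ) 1 := ⟨ht'.1, ht'.2.le⟩
          have hm0 := hmem v hvr t ht
          have hm1 := hmem (v + h) hvh t ht
          rw [hintg _ (hRV hm0) v h (α v t)]
          have A0 := hb0 _ hm0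
          have A1 := frob_opb _ (hb1 _ hm0) (le_refl ‖h‖)
          have A2 := hb2 _ hm0 _ hm1
          have A3 := a2 t ht
          have A4 := b2 t ht
          have hd : p + t • (v + h) - (p + t • v) = t • h := by rw [smul_add]; abel
          rw [hd, map_smul] at A2
          exact frob_est _ _ _ _ _ v h t K M ht hK hM0 hv1 hh A0 A1 A2 A3 A4) 1 (by simp)
      have hgb : gronwallBound 0 (5 * K) (Cc * ‖h‖ ^ 2) (1 - 0)
          = gronwallBound 0 (5 * K) Cc 1 * ‖h‖ ^ 2 := by
        rw [gronwallBound_of_K_ne_0 (by positivity), gronwallBound_of_K_ne_0 (by positivity)]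
        simp; ring
      rw [hgb] at this
      simpa [← hpv] using this
    rw [hasFDerivAt_iff_isLittleO_nhds_zero]
    have hev : ∀ᶠ h in nhds (0 : X), ‖v + h‖ < r := by
      have : ContinuousAt (fun h : X => ‖v + h‖) 0 := by fun_prop
      exact this.eventually_lt_const (by simpa using hvr)
    refine Asymptotics.IsBigO.trans_isLittleO (g := fun h : X => ‖h‖ ^ 2) ?_
      (Asymptotics.isLittleO_norm_pow_id one_lt_two)
    refine Asymptotics.IsBigO.of_bound (gronwallBound 0 (5 * K) Cc 1) ?_
    filter_upwards [hev] with h hh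
    have := hest h hh
    have e : x + h - p = v + h := by rw [hv]; abel
    simpa [e] using this

end

open Loc

namespace Loc
open Matrix
variable {n : ℕ}

/-- Smooth scalar functions on `V`. -/
abbrev Sm (V : Set (Pt n)) (f : Pt n → ℝ) : Prop := ContDiffOn ℝ (⊤ : ℕ∞) f V

theorem Sm.diff {V : Set (Pt n)} {f : Pt n → ℝ} (hf : Sm V f) (hV : IsOpen V) {p : Pt n}
    (hp : p ∈ V) : DifferentiableAt ℝ f p :=
  (hf.contDiffAt (hV.mem_nhds hp)).differentiableAt (by simp)

theorem Sm.pd {V : Set (Pt n)} {f : Pt n → ℝ} (hf : Sm V f) (hV : IsOpen V) (i : Fin n) :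
    Sm V (pd i f) := by
  have h : ContDiffOn ℝ (⊤ : ℕ∞) (fderiv ℝ f) V := hf.fderiv_of_isOpen hV (by simp)
  exact h.clm_apply contDiffOn_const

theorem pd_congr {V : Set (Pt n)} (hV : IsOpen V) {p : Pt n} (hp : p ∈ V) {f g : Pt n → ℝ}
    (h : ∀ q ∈ V, f q = g q) (i : Fin n) : pd i f p = pd i g p := by
  have : f =ᶠ[nhds p] g := Filter.eventuallyEq_of_mem (hV.mem_nhds hp) h
  unfold pd
  rw [this.fderiv_eq]

theorem pd_const (c : ℝ) (i : Fin n) (p : Pt n) : pd i (fun _ => c) p = 0 := by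
  simp [pd]

theorem pd_add {f g : Pt n → ℝ} {p : Pt n} (hf : DifferentiableAt ℝ f p)
    (hg : DifferentiableAt ℝ g p) (i : Fin n) :
    pd i (fun q => f q + g q) p = pd i f p + pd i g p := by
  unfold pd; rw [fderiv_fun_add hf hg]; simp

theorem pd_sub {f g : Pt n → ℝ} {p : Pt n} (hf : DifferentiableAt ℝ f p)
    (hg : DifferentiableAt ℝ g p) (i : Fin n) :
    pd i (fun q => f q - g q) p = pd i f p - pd i g p := by
  unfold pd; rw [fderiv_fun_sub hf hg]; simp

theorem pd_neg {f : Pt n → ℝ} {p : Pt n} (i : Fin n) :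
    pd i (fun q => - f q) p = - pd i f p := by
  unfold pd; rw [fderiv_fun_neg]; simp

theorem pd_mul {f g : Pt n → ℝ} {p : Pt n} (hf : DifferentiableAt ℝ f p)
    (hg : DifferentiableAt ℝ g p) (i : Fin n) :
    pd i (fun q => f q * g q) p = pd i f p * g p + f p * pd i g p := by
  unfold pd; rw [fderiv_fun_mul hf hg]; simp; ring

theorem pd_sum {ι : Type*} {t : Finset ι} {f : ι → Pt n → ℝ} {p : Pt n}
    (hf : ∀ a ∈ t, DifferentiableAt ℝ (f a) p) (i : Fin n) :
    pd i (fun q => ∑ a ∈ t, f a q) p = ∑ a ∈ t, pd i (f a) p := by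
  unfold pd; rw [fderiv_fun_sum hf]; simp

theorem pd_exp {f : Pt n → ℝ} {p : Pt n} (hf : DifferentiableAt ℝ f p) (i : Fin n) :
    pd i (fun q => Real.exp (f q)) p = Real.exp (f p) * pd i f p := by
  unfold pd; rw [fderiv_exp hf]; simp

theorem pd_log {f : Pt n → ℝ} {p : Pt n} (hf : DifferentiableAt ℝ f p) (h0 : f p ≠ 0)
    (i : Fin n) : pd i (fun q => Real.log (f q)) p = pd i f p / f p := by
  unfold pd; rw [fderiv.log hf h0]; simp; field_simp

theorem pd_div {f g : Pt n → ℝ} {p : Pt n} (hf : DifferentiableAt ℝ f p)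
    (hg : DifferentiableAt ℝ g p) (h0 : g p ≠ 0) (i : Fin n) :
    pd i (fun q => f q / g q) p = pd i f p / g p - f p * pd i g p / (g p) ^ 2 := by
  have h1 : HasFDerivAt (fun q => (g q)⁻¹) _ p :=
    (hasDerivAt_inv h0).comp_hasFDerivAt p hg.hasFDerivAt
  simp only [div_eq_mul_inv]
  rw [pd_mul hf h1.differentiableAt]
  have h2 : pd i (fun q => (g q)⁻¹) p = -(g p ^ 2)⁻¹ * pd i g p := by
    unfold pd; rw [h1.fderiv]; simp
  rw [h2]; ring

theorem pd_comm {V : Set (Pt n)} {f : Pt n → ℝ} (hf : Sm V f) (hV : IsOpen V) {p : Pt n}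
    (hp : p ∈ V) (i j : Fin n) : pd i (pd j f) p = pd j (pd i f) p := by
  have hc : ContDiffAt ℝ (⊤ : ℕ∞) f p := hf.contDiffAt (hV.mem_nhds hp)
  have hd : DifferentiableAt ℝ (fderiv ℝ f) p :=
    (hc.fderiv_right (m := 1) (by norm_cast)).differentiableAt (by simp)
  have hs : IsSymmSndFDerivAt ℝ f p := hc.isSymmSndFDerivAt (by simp; exact WithTop.coe_le_coe.2 (le_top (a := (2:ℕ∞))))
  have key : ∀ i j : Fin n, pd i (pd j f) p
      = fderiv ℝ (fderiv ℝ f) p (Pi.single i 1) (Pi.single j 1) := by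
    intro i j
    have := (hd.hasFDerivAt.clm_apply (hasFDerivAt_const (Pi.single j (1:ℝ)) p)).fderiv
    unfold pd
    rw [this]; simp
  rw [key, key]
  exact hs.eq _ _

theorem Sm.congr' {V : Set (Pt n)} {f g : Pt n → ℝ} (hf : Sm V f) (h : ∀ q ∈ V, g q = f q) :
    Sm V g := ContDiffOn.congr hf h

theorem Sm.sum {V : Set (Pt n)} {ι : Type*} {t : Finset ι} {f : ι → Pt n → ℝ}
    (hf : ∀ a ∈ t, Sm V (f a)) : Sm V (fun q => ∑ a ∈ t, f a q) := ContDiffOn.sum hf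

theorem Sm.prod {V : Set (Pt n)} {ι : Type*} {t : Finset ι} {f : ι → Pt n → ℝ}
    (hf : ∀ a ∈ t, Sm V (f a)) : Sm V (fun q => ∏ a ∈ t, f a q) := contDiffOn_prod hf

theorem Sm.det {V : Set (Pt n)} {m : ℕ} {M : Pt n → Matrix (Fin m) (Fin m) ℝ}
    (hM : ∀ i j, Sm V (fun q => M q i j)) : Sm V (fun q => (M q).det) := by
  simp only [Matrix.det_apply]
  refine Sm.sum fun σ _ => ?_
  exact ContDiffOn.const_smul _ (Sm.prod fun i _ => hM _ _)

theorem Sm.inv {V : Set (Pt n)} {M : Pt n → Mat n} (hM : ∀ i j, Sm V (fun q => M q i j))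
    (h0 : ∀ q ∈ V, (M q).det ≠ 0) (i j : Fin n) : Sm V (fun q => (M q)⁻¹ i j) := by
  have : (fun q => (M q)⁻¹ i j)
      = fun q => ((M q).det)⁻¹ * ((M q).updateRow j (Pi.single i 1)).det := by
    funext q
    rw [Matrix.inv_def, Matrix.smul_apply, Matrix.adjugate_apply, Ring.inverse_eq_inv',
      smul_eq_mul]
  rw [this]
  refine ContDiffOn.mul (ContDiffOn.inv (Sm.det hM) h0) (Sm.det fun k l => ?_)
  by_cases hk : k = j
  · subst hk; simp only [Matrix.updateRow_self]; exact contDiffOn_const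
  · simp only [Matrix.updateRow_ne hk]; exact hM k l

/-- Conformally flat local data: `g = e^{-2σ} JᵀJ` with `J` a closed invertible coframe,
`dσ = Jᵀ s`. -/
structure Fr (V : Set (Pt n)) (J : Pt n → Mat n) (σ : Pt n → ℝ) (s : Pt n → Fin n → ℝ)
    (g : Pt n → Mat n) : Prop where
  hV : IsOpen V
  hJ : ∀ a j, Sm V (fun q => J q a j)
  cl : ∀ q ∈ V, ∀ a i j, pd i (fun q => J q a j) q = pd j (fun q => J q a i) q
  det : ∀ q ∈ V, (J q).det ≠ 0
  hσ : Sm V σ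
  hs : ∀ a, Sm V (fun q => s q a)
  sJ : ∀ q ∈ V, ∀ i, pd i σ q = ∑ a, s q a * J q a i
  hg : ∀ q ∈ V, ∀ i j, g q i j = Real.exp (-2 * σ q) * ∑ a, J q a i * J q a j

/-- The tensor `B`, with Schouten tensor `BᵀJ`. -/
def Bt (J : Pt n → Mat n) (σ : Pt n → ℝ) (s : Pt n → Fin n → ℝ) (q : Pt n) : Mat n :=
  Matrix.of fun a i => pd i (fun q => s q a) q + pd i σ q * s q a
    - (1 / 2) * (∑ b, s q b * s q b) * J q a i

theorem Fr.gmat {V : Set (Pt n)} {J : Pt n → Mat n} {σ : Pt n → ℝ} {s : Pt n → Fin n → ℝ}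
    {g : Pt n → Mat n} (F : Fr V J σ s g) {q : Pt n} (hq : q ∈ V) :
    g q = Real.exp (-2 * σ q) • ((J q)ᵀ * J q) := by
  ext i j
  rw [F.hg q hq, Matrix.smul_apply, Matrix.mul_apply]; rfl

theorem Fr.gdet {V : Set (Pt n)} {J : Pt n → Mat n} {σ : Pt n → ℝ} {s : Pt n → Fin n → ℝ}
    {g : Pt n → Mat n} (F : Fr V J σ s g) {q : Pt n} (hq : q ∈ V) :
    (g q).det ≠ 0 := by
  rw [F.gmat hq, Matrix.det_smul, Matrix.det_mul, Matrix.det_transpose]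
  have := F.det q hq
  positivity

theorem Fr.gsm {V : Set (Pt n)} {J : Pt n → Mat n} {σ : Pt n → ℝ} {s : Pt n → Fin n → ℝ}
    {g : Pt n → Mat n} (F : Fr V J σ s g) (i j : Fin n) : Sm V (fun q => g q i j) := by
  refine Sm.congr' (f := fun q => Real.exp (-2 * σ q) * ∑ a, J q a i * J q a j) ?_
    (fun q hq => F.hg q hq i j)
  exact (ContDiffOn.exp (contDiffOn_const.mul F.hσ)).mul
    (Sm.sum fun a _ => (F.hJ a i).mul (F.hJ a j))

theorem christoffel_sm {V : Set (Pt n)} (hV : IsOpen V) {g : Pt n → Mat n}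
    (hg : ∀ i j, Sm V (fun q => g q i j)) (h0 : ∀ q ∈ V, (g q).det ≠ 0) (k i j : Fin n) :
    Sm V (christoffel g k i j) := by
  unfold christoffel
  refine contDiffOn_const.mul (Sm.sum fun l _ => ?_)
  exact (Sm.inv hg h0 k l).mul
    ((((hg j l).pd hV i).add ((hg i l).pd hV j)).sub ((hg i j).pd hV l))

/-- Lowering an index of the Christoffel symbols. -/
theorem christoffel_lower (g : Pt n → Mat n) {q : Pt n} (h0 : (g q).det ≠ 0) (m i j : Fin n) :
    ∑ k, g q m k * christoffel g k i j q
      = (1 / 2) * (pd i (fun q => g q j m) q + pd j (fun q => g q i m) q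
          - pd m (fun q => g q i j) q) := by
  set c : Fin n → ℝ := fun l => pd i (fun q => g q j l) q + pd j (fun q => g q i l) q
          - pd l (fun q => g q i j) q with hc
  have h1 : (fun k => christoffel g k i j q) = (1 / 2 : ℝ) • ((g q)⁻¹ *ᵥ c) := by
    funext k
    simp [christoffel, hc, Matrix.mulVec, dotProduct]
  have h2 : ∑ k, g q m k * christoffel g k i j q = (g q *ᵥ fun k => christoffel g k i j q) m := rfl
  rw [h2, h1, Matrix.mulVec_smul, Matrix.mulVec_mulVec,
    Matrix.mul_nonsing_inv _ (isUnit_iff_ne_zero.2 h0), Matrix.one_mulVec]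
  simp [hc]

end Loc

open Loc

namespace Loc
open Matrix
variable {n : ℕ}

theorem eq_of_coframe {M : Mat n} (h0 : M.det ≠ 0) {v w : Fin n → ℝ}
    (h : ∀ a, ∑ k, M a k * v k = ∑ k, M a k * w k) : v = w := by
  have : M *ᵥ (v - w) = 0 := by
    funext a
    simp only [Matrix.mulVec, dotProduct, Pi.sub_apply, mul_sub, Finset.sum_sub_distrib, h a,
      sub_self, Pi.zero_apply]
  exact sub_eq_zero.1 (Matrix.eq_zero_of_mulVec_eq_zero h0 this)

section
variable {V : Set (Pt n)} {J : Pt n → Mat n} {σ : Pt n → ℝ} {s : Pt n → Fin n → ℝ}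
    {g : Pt n → Mat n}

theorem Fr.pdhat (F : Fr V J σ s g) {q : Pt n} (hq : q ∈ V) (m i j : Fin n) :
    pd m (fun q => ∑ a, J q a i * J q a j) q
      = (∑ a, pd m (fun q => J q a i) q * J q a j)
        + ∑ a, pd m (fun q => J q a j) q * J q a i := by
  rw [pd_sum fun a _ => ((F.hJ a i).diff F.hV hq).fun_mul ((F.hJ a j).diff F.hV hq),
    ← Finset.sum_add_distrib]
  refine Finset.sum_congr rfl fun a _ => ?_
  rw [pd_mul ((F.hJ a i).diff F.hV hq) ((F.hJ a j).diff F.hV hq)]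
  ring

theorem Fr.pdg (F : Fr V J σ s g) {q : Pt n} (hq : q ∈ V) (m i j : Fin n) :
    pd m (fun q => g q i j) q = Real.exp (-2 * σ q) *
      (-2 * pd m σ q * (∑ a, J q a i * J q a j)
        + (∑ a, pd m (fun q => J q a i) q * J q a j)
        + ∑ a, pd m (fun q => J q a j) q * J q a i) := by
  have h1 : Sm V (fun q => -2 * σ q) := contDiffOn_const.mul F.hσ
  have h2 : Sm V (fun q => ∑ a, J q a i * J q a j) :=
    Sm.sum fun a _ => (F.hJ a i).mul (F.hJ a j)
  rw [pd_congr F.hV hq (fun q hq => F.hg q hq i j), pd_mul (Sm.diff h1.exp F.hV hq)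
    (h2.diff F.hV hq), pd_exp (h1.diff F.hV hq), F.pdhat hq,
    pd_mul (differentiableAt_const _) (F.hσ.diff F.hV hq), pd_const]
  ring

theorem Fr.chr (F : Fr V J σ s g) {q : Pt n} (hq : q ∈ V) (a i j : Fin n) :
    ∑ k, J q a k * christoffel g k i j q
      = pd i (fun q => J q a j) q - J q a i * pd j σ q - J q a j * pd i σ q
        + s q a * ∑ b, J q b i * J q b j := by
  have key : (fun a => ∑ k, J q a k * christoffel g k i j q)
      = fun a => pd i (fun q => J q a j) q - J q a i * pd j σ q - J q a j * pd i σ q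
        + s q a * ∑ b, J q b i * J q b j := by
    refine eq_of_coframe (M := (J q)ᵀ) (by rw [Matrix.det_transpose]; exact F.det q hq) fun m => ?_
    simp only [Matrix.transpose_apply]
    have he : Real.exp (-2 * σ q) ≠ 0 := (Real.exp_pos _).ne'
    refine mul_left_cancel₀ he ?_
    have h1 : Real.exp (-2 * σ q) * ∑ a, J q a m * ∑ k, J q a k * christoffel g k i j q
        = ∑ k, g q m k * christoffel g k i j q := by
      simp only [F.hg q hq, Finset.mul_sum, Finset.sum_mul]
      rw [Finset.sum_comm]
      refine Finset.sum_congr rfl fun a _ => Finset.sum_congr rfl fun k _ => by ring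
    rw [h1, christoffel_lower g (F.gdet hq), F.pdg hq, F.pdg hq, F.pdg hq]
    have h2 : ∑ a, J q a m * (pd i (fun q => J q a j) q - J q a i * pd j σ q
          - J q a j * pd i σ q + s q a * ∑ b, J q b i * J q b j)
        = (∑ a, pd i (fun q => J q a j) q * J q a m)
          - (∑ a, J q a i * J q a m) * pd j σ q - (∑ a, J q a j * J q a m) * pd i σ q
          + pd m σ q * ∑ b, J q b i * J q b j := by
      rw [F.sJ q hq m]
      simp only [Finset.sum_mul, ← Finset.sum_sub_distrib, ← Finset.sum_add_distrib]
      refine Finset.sum_congr rfl fun a _ => by ring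
    rw [h2]
    have c1 : ∑ a, pd i (fun q => J q a m) q * J q a j
        = ∑ a, pd m (fun q => J q a i) q * J q a j :=
      Finset.sum_congr rfl fun a _ => by rw [F.cl q hq a i m]
    have c2 : ∑ a, pd j (fun q => J q a m) q * J q a i
        = ∑ a, pd m (fun q => J q a j) q * J q a i :=
      Finset.sum_congr rfl fun a _ => by rw [F.cl q hq a j m]
    have c3 : ∑ a, pd j (fun q => J q a i) q * J q a m
        = ∑ a, pd i (fun q => J q a j) q * J q a m :=
      Finset.sum_congr rfl fun a _ => by rw [F.cl q hq a j i]
    rw [c1, c2, c3]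
    ring
  exact congrFun key a

/-- Derivative of the gradient relation `dσ = Jᵀ s`. -/
theorem Fr.hess (F : Fr V J σ s g) {q : Pt n} (hq : q ∈ V) (i k : Fin n) :
    pd i (pd k σ) q = (∑ b, s q b * pd i (fun q => J q b k) q)
      + ∑ b, pd i (fun q => s q b) q * J q b k := by
  rw [pd_congr F.hV hq (fun q hq => F.sJ q hq k),
    pd_sum fun a _ => ((F.hs a).diff F.hV hq).fun_mul ((F.hJ a k).diff F.hV hq),
    ← Finset.sum_add_distrib]
  refine Finset.sum_congr rfl fun a _ => ?_
  rw [pd_mul ((F.hs a).diff F.hV hq) ((F.hJ a k).diff F.hV hq)]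
  ring

theorem Fr.bj (F : Fr V J σ s g) {q : Pt n} (hq : q ∈ V) (j k : Fin n) :
    ∑ b, Bt J σ s q b j * J q b k = (∑ b, pd j (fun q => s q b) q * J q b k)
      + pd j σ q * pd k σ q - (1 / 2) * (∑ b, s q b * s q b) * ∑ b, J q b j * J q b k := by
  rw [F.sJ q hq k, Finset.mul_sum, Finset.mul_sum, ← Finset.sum_add_distrib,
    ← Finset.sum_sub_distrib]
  refine Finset.sum_congr rfl fun b _ => ?_
  simp only [Bt, Matrix.of_apply]; ring

theorem Fr.bsymm (F : Fr V J σ s g) {q : Pt n} (hq : q ∈ V) (j k : Fin n) :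
    ∑ b, Bt J σ s q b j * J q b k = ∑ b, Bt J σ s q b k * J q b j := by
  rw [F.bj hq, F.bj hq]
  have h1 := F.hess hq j k
  have h2 := F.hess hq k j
  rw [pd_comm F.hσ F.hV hq j k] at h1
  have h3 : ∑ b, s q b * pd j (fun q => J q b k) q = ∑ b, s q b * pd k (fun q => J q b j) q :=
    Finset.sum_congr rfl fun b _ => by rw [F.cl q hq b j k]
  have h4 : ∑ b, J q b j * J q b k = ∑ b, J q b k * J q b j :=
    Finset.sum_congr rfl fun b _ => by ring
  rw [h4]
  linarith

theorem Fr.pdP (F : Fr V J σ s g) {q : Pt n} (hq : q ∈ V) (a i j k : Fin n) :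
    pd i (fun q => pd j (fun q => J q a k) q - J q a j * pd k σ q - J q a k * pd j σ q
        + s q a * ∑ b, J q b j * J q b k) q
      = pd i (pd j (fun q => J q a k)) q
        - (pd i (fun q => J q a j) q * pd k σ q + J q a j * pd i (pd k σ) q)
        - (pd i (fun q => J q a k) q * pd j σ q + J q a k * pd i (pd j σ) q)
        + (pd i (fun q => s q a) q * (∑ b, J q b j * J q b k)
          + s q a * ((∑ b, pd i (fun q => J q b j) q * J q b k)
            + ∑ b, pd i (fun q => J q b k) q * J q b j)) := by
  have d1 := ((F.hJ a k).pd F.hV j).diff F.hV hq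
  have d2 := (F.hJ a j).diff F.hV hq
  have d3 := (F.hJ a k).diff F.hV hq
  have d4 := (F.hσ.pd F.hV k).diff F.hV hq
  have d5 := (F.hσ.pd F.hV j).diff F.hV hq
  have d6 := (F.hs a).diff F.hV hq
  have d7 : DifferentiableAt ℝ (fun q => ∑ b, J q b j * J q b k) q :=
    Sm.diff (Sm.sum fun a _ => (F.hJ a j).mul (F.hJ a k)) F.hV hq
  rw [pd_add ((d1.fun_sub (d2.fun_mul d4)).fun_sub (d3.fun_mul d5)) (d6.fun_mul d7),
    pd_sub (d1.fun_sub (d2.fun_mul d4)) (d3.fun_mul d5), pd_sub d1 (d2.fun_mul d4), pd_mul d2 d4, pd_mul d3 d5,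
    pd_mul d6 d7, F.pdhat hq]

theorem Fr.dchr (F : Fr V J σ s g) {q : Pt n} (hq : q ∈ V) (a i j k : Fin n) :
    ∑ l, J q a l * pd i (christoffel g l j k) q
      = pd i (fun q => pd j (fun q => J q a k) q - J q a j * pd k σ q - J q a k * pd j σ q
        + s q a * ∑ b, J q b j * J q b k) q
        - ∑ l, pd i (fun q => J q a l) q * christoffel g l j k q := by
  rw [← pd_congr F.hV hq (fun q hq => F.chr hq a j k)]
  have hc : ∀ l, DifferentiableAt ℝ (christoffel g l j k) q := fun l =>
    (christoffel_sm F.hV F.gsm (fun q hq => F.gdet hq) l j k).diff F.hV hq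
  rw [pd_sum fun l _ => ((F.hJ a l).diff F.hV hq).fun_mul (hc l), ← Finset.sum_sub_distrib]
  refine Finset.sum_congr rfl fun l _ => ?_
  rw [pd_mul ((F.hJ a l).diff F.hV hq) (hc l)]
  ring

theorem Fr.quad (F : Fr V J σ s g) {q : Pt n} (hq : q ∈ V) (a i j k : Fin n) :
    ∑ l, J q a l * ∑ m, christoffel g l i m q * christoffel g m j k q
      = (∑ l, pd i (fun q => J q a l) q * christoffel g l j k q)
        - J q a i * ∑ b, s q b * (pd j (fun q => J q b k) q - J q b j * pd k σ q
            - J q b k * pd j σ q + s q b * ∑ c, J q c j * J q c k)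
        - pd i σ q * (pd j (fun q => J q a k) q - J q a j * pd k σ q
            - J q a k * pd j σ q + s q a * ∑ c, J q c j * J q c k)
        + s q a * ∑ b, J q b i * (pd j (fun q => J q b k) q - J q b j * pd k σ q
            - J q b k * pd j σ q + s q b * ∑ c, J q c j * J q c k) := by
  simp only [← F.chr hq]
  have h1 : ∑ l, J q a l * ∑ m, christoffel g l i m q * christoffel g m j k q
      = ∑ m, (∑ l, J q a l * christoffel g l i m q) * christoffel g m j k q := by
    simp only [Finset.mul_sum, Finset.sum_mul]
    rw [Finset.sum_comm]
    refine Finset.sum_congr rfl fun m _ => Finset.sum_congr rfl fun l _ => by ring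
  have h2 : ∑ b, s q b * ∑ m, J q b m * christoffel g m j k q
      = ∑ m, pd m σ q * christoffel g m j k q := by
    simp only [F.sJ q hq, Finset.mul_sum, Finset.sum_mul]
    rw [Finset.sum_comm]
    refine Finset.sum_congr rfl fun m _ => Finset.sum_congr rfl fun l _ => by ring
  have h3 : ∑ b, J q b i * ∑ m, J q b m * christoffel g m j k q
      = ∑ m, (∑ b, J q b i * J q b m) * christoffel g m j k q := by
    simp only [Finset.mul_sum, Finset.sum_mul]
    rw [Finset.sum_comm]
    refine Finset.sum_congr rfl fun m _ => Finset.sum_congr rfl fun l _ => by ring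
  rw [h1, h2, h3, Finset.mul_sum (a := J q a i), Finset.mul_sum (a := pd i σ q),
    Finset.mul_sum (a := s q a), ← Finset.sum_sub_distrib, ← Finset.sum_sub_distrib,
    ← Finset.sum_add_distrib]
  refine Finset.sum_congr rfl fun m _ => ?_
  rw [F.chr hq]
  ring

/-- The curvature of `e^{-2σ} JᵀJ` in the frame `J`. -/
theorem Fr.riem (F : Fr V J σ s g) {q : Pt n} (hq : q ∈ V) (a i j k : Fin n) :
    ∑ l, J q a l * riemann g l i j k q
      = Bt J σ s q a i * (∑ b, J q b j * J q b k) - Bt J σ s q a j * (∑ b, J q b i * J q b k)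
        + J q a i * (∑ b, Bt J σ s q b j * J q b k)
        - J q a j * (∑ b, Bt J σ s q b i * J q b k) := by
  have e1 : ∑ l, J q a l * riemann g l i j k q
      = ((∑ l, J q a l * pd i (christoffel g l j k) q)
          + ∑ l, J q a l * ∑ m, christoffel g l i m q * christoffel g m j k q)
        - ((∑ l, J q a l * pd j (christoffel g l i k) q)
          + ∑ l, J q a l * ∑ m, christoffel g l j m q * christoffel g m i k q) := by
    simp only [← Finset.sum_sub_distrib, ← Finset.sum_add_distrib]
    refine Finset.sum_congr rfl fun l _ => ?_
    rw [riemann, Finset.sum_sub_distrib]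
    ring
  have e2 : ∀ j, ∑ b, s q b * (pd j (fun q => J q b k) q - J q b j * pd k σ q
            - J q b k * pd j σ q + s q b * ∑ c, J q c j * J q c k)
      = (∑ b, s q b * pd j (fun q => J q b k) q) - pd j σ q * pd k σ q - pd k σ q * pd j σ q
        + (∑ b, s q b * s q b) * ∑ c, J q c j * J q c k := by
    intro j
    rw [show pd j σ q * pd k σ q = (∑ b, s q b * J q b j) * pd k σ q by rw [← F.sJ q hq],
      show pd k σ q * pd j σ q = (∑ b, s q b * J q b k) * pd j σ q by rw [← F.sJ q hq],
      Finset.sum_mul, Finset.sum_mul, Finset.sum_mul, ← Finset.sum_sub_distrib,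
      ← Finset.sum_sub_distrib, ← Finset.sum_add_distrib]
    refine Finset.sum_congr rfl fun b _ => ?_
    ring
  have e3 : ∀ i j, ∑ b, J q b i * (pd j (fun q => J q b k) q - J q b j * pd k σ q
            - J q b k * pd j σ q + s q b * ∑ c, J q c j * J q c k)
      = (∑ b, pd j (fun q => J q b k) q * J q b i) - (∑ c, J q c i * J q c j) * pd k σ q
        - (∑ c, J q c i * J q c k) * pd j σ q + pd i σ q * ∑ c, J q c j * J q c k := by
    intro i j
    rw [F.sJ q hq i, Finset.sum_mul, Finset.sum_mul, Finset.sum_mul, ← Finset.sum_sub_distrib,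
      ← Finset.sum_sub_distrib, ← Finset.sum_add_distrib]
    refine Finset.sum_congr rfl fun b _ => ?_
    ring
  rw [e1, F.dchr hq, F.dchr hq, F.quad hq, F.quad hq, F.pdP hq, F.pdP hq, e2, e2, e3, e3,
    F.bj hq, F.bj hq, F.hess hq i k, F.hess hq j k]
  have c1 := pd_comm (F.hJ a k) F.hV hq i j
  have c2 := pd_comm F.hσ F.hV hq i j
  have c3 := F.cl q hq a i j
  have c4 : ∑ b, pd i (fun q => J q b j) q * J q b k = ∑ b, pd j (fun q => J q b i) q * J q b k :=
    Finset.sum_congr rfl fun b _ => by rw [F.cl q hq b i j]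
  have c5 : ∑ c, J q c j * J q c i = ∑ c, J q c i * J q c j :=
    Finset.sum_congr rfl fun b _ => by ring
  rw [c1, c2, c3, c4, c5]
  simp only [Bt, Matrix.of_apply]
  ring

theorem Fr.flat (F : Fr V J σ s g) (h0 : ∀ q ∈ V, Bt J σ s q = 0) : FlatOn g V := by
  intro q hq l i j k
  have : (fun l => riemann g l i j k q) = 0 := by
    refine eq_of_coframe (F.det q hq) fun a => ?_
    rw [F.riem hq, h0 q hq]; simp
  exact congrFun this l

/-- The Schouten tensor of `e^{-2σ} JᵀJ`. -/
theorem Fr.schouten (F : Fr V J σ s g) (hn : 3 ≤ n) {q : Pt n} (hq : q ∈ V) :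
    schouten g q = (Bt J σ s q)ᵀ * J q := by
  set B := Bt J σ s q with hB
  set A := Bᵀ * J q with hA
  have hdet := F.det q hq
  have hu : IsUnit (J q).det := isUnit_iff_ne_zero.2 hdet
  set I := (J q)⁻¹ with hI
  have hIJ : I * J q = 1 := Matrix.nonsing_inv_mul _ hu
  have hJI : J q * I = 1 := Matrix.mul_nonsing_inv _ hu
  set G := (J q)ᵀ * J q with hG
  have hGij : ∀ i j, G i j = ∑ b, J q b i * J q b j := fun i j => rfl
  have hAij : ∀ i j, A i j = ∑ b, B b i * J q b j := fun i j => rfl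
  have hR : ∀ l i j k, riemann g l i j k q
      = (I * B) l i * G j k - (I * B) l j * G i k + (1 : Mat n) l i * A j k
        - (1 : Mat n) l j * A i k := by
    intro l i j k
    have h1 : (fun l => riemann g l i j k q) = I *ᵥ (J q *ᵥ fun l => riemann g l i j k q) := by
      rw [Matrix.mulVec_mulVec, hIJ, Matrix.one_mulVec]
    have h2 : (J q *ᵥ fun l => riemann g l i j k q)
        = fun a => B a i * G j k - B a j * G i k + J q a i * A j k - J q a j * A i k := by
      funext a
      exact F.riem hq a i j k
    rw [congrFun h1 l, h2, ← hIJ]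
    simp only [Matrix.mulVec, dotProduct, Matrix.mul_apply, Finset.sum_mul]
    rw [← Finset.sum_sub_distrib, ← Finset.sum_add_distrib, ← Finset.sum_sub_distrib]
    refine Finset.sum_congr rfl fun a _ => by ring
  have hric : ∀ j k, ricci g j k q = (I * B).trace * G j k + ((n : ℝ) - 2) * A j k := by
    intro j k
    simp only [ricci, hR]
    rw [Finset.sum_sub_distrib, Finset.sum_add_distrib, Finset.sum_sub_distrib]
    have t1 : ∑ i, (I * B) i i * G j k = (I * B).trace * G j k := by
      rw [← Finset.sum_mul]; rfl
    have t2 : ∑ i, (I * B) i j * G i k = A j k := by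
      have : (I * B)ᵀ * G = A := by
        rw [hG, Matrix.transpose_mul, Matrix.mul_assoc, ← Matrix.mul_assoc Iᵀ,
          ← Matrix.transpose_mul, hJI, Matrix.transpose_one, Matrix.one_mul]
      rw [← this]; rfl
    have t3 : ∑ i, (1 : Mat n) i i * A j k = n * A j k := by
      simp
    have t4 : ∑ i, (1 : Mat n) i j * A i k = A j k := by
      simp [Matrix.one_apply]
    rw [t1, t2, t3, t4]; ring
  have hgi : (g q)⁻¹ = Real.exp (2 * σ q) • (I * Iᵀ) := by
    refine Matrix.inv_eq_right_inv ?_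
    rw [F.gmat hq, Matrix.smul_mul, Matrix.mul_smul, smul_smul, ← Real.exp_add]
    have : (J q)ᵀ * J q * (I * Iᵀ) = 1 := by
      rw [Matrix.mul_assoc, ← Matrix.mul_assoc (J q) I, hJI, Matrix.one_mul,
        ← Matrix.transpose_mul, hIJ, Matrix.transpose_one]
    rw [this]; simp
  have hsym : Aᵀ = A := by
    ext i j
    exact F.bsymm hq j i
  have hS : scalarCurv g q = Real.exp (2 * σ q) * (2 * ((n:ℝ) - 1) * (I * B).trace) := by
    have hGs : Gᵀ = G := by rw [hG, Matrix.transpose_mul, Matrix.transpose_transpose]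
    have u1 : ∀ M : Mat n, Mᵀ = M → ∑ j, ∑ k, (I * Iᵀ) j k * M j k = (I * Iᵀ * M).trace := by
      intro M hM
      simp only [Matrix.trace, Matrix.diag, Matrix.mul_apply (M := I * Iᵀ)]
      refine Finset.sum_congr rfl fun j _ => Finset.sum_congr rfl fun k _ => ?_
      conv_lhs => rw [← hM]
      rfl
    have u2 : (I * Iᵀ * G).trace = n := by
      rw [hG, Matrix.mul_assoc, ← Matrix.mul_assoc Iᵀ, ← Matrix.transpose_mul, hJI,
        Matrix.transpose_one, Matrix.one_mul, hIJ, Matrix.trace_one, Fintype.card_fin]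
    have u3 : (I * Iᵀ * A).trace = (I * B).trace := by
      rw [← hsym, hA, Matrix.transpose_mul, Matrix.transpose_transpose, Matrix.mul_assoc,
        ← Matrix.mul_assoc Iᵀ, ← Matrix.transpose_mul, hJI, Matrix.transpose_one, Matrix.one_mul]
    have u4 : scalarCurv g q = Real.exp (2 * σ q) * ((I * B).trace *
        (∑ j, ∑ k, (I * Iᵀ) j k * G j k) + ((n : ℝ) - 2) * ∑ j, ∑ k, (I * Iᵀ) j k * A j k) := by
      simp only [scalarCurv, hgi, hric, Matrix.smul_apply, smul_eq_mul, Finset.mul_sum,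
        ← Finset.sum_add_distrib]
      refine Finset.sum_congr rfl fun j _ => Finset.sum_congr rfl fun k _ => by ring
    rw [u4, u1 G hGs, u1 A hsym, u2, u3]; ring
  have hn' : (3 : ℝ) ≤ n := by exact_mod_cast hn
  have n2 : (n : ℝ) - 2 ≠ 0 := by linarith
  have n1 : (n : ℝ) - 1 ≠ 0 := by linarith
  ext i j
  rw [Loc.schouten, Matrix.smul_apply, Matrix.of_apply, hric, hS, F.gmat hq, Matrix.smul_apply,
    ← hG, smul_eq_mul, smul_eq_mul]
  have : Real.exp (-2 * σ q) = (Real.exp (2 * σ q))⁻¹ := by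
    rw [← Real.exp_neg]; congr 1; ring
  rw [this]
  have hx := (Real.exp_pos (2 * σ q)).ne'
  field_simp
  ring

end

end Loc

open Loc

namespace Loc
open Matrix
variable {n : ℕ}

section
variable {V : Set (Pt n)} {J : Pt n → Mat n} {σ : Pt n → ℝ} {s : Pt n → Fin n → ℝ}
    {g : Pt n → Mat n}

/-- Squared norm of `s`. -/
def Ssq (s : Pt n → Fin n → ℝ) (q : Pt n) : ℝ := ∑ b, s q b * s q b

/-- The dual coframe. -/
def Ldual (J : Pt n → Mat n) (s : Pt n → Fin n → ℝ) (q : Pt n) : Mat n :=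
  Matrix.of fun a j => J q a j - pd j (fun q => 2 * s q a / Ssq s q) q

/-- The dual conformal exponent. -/
def taudual (σ : Pt n → ℝ) (s : Pt n → Fin n → ℝ) (q : Pt n) : ℝ :=
  Real.log 2 - σ q - Real.log (Ssq s q)

/-- The reflection in `s`. -/
def Qr (s : Pt n → Fin n → ℝ) (q : Pt n) : Mat n :=
  1 - (2 / Ssq s q) • Matrix.vecMulVec (s q) (s q)

theorem Qr_symm (q : Pt n) : (Qr s q)ᵀ = Qr s q := by
  simp [Qr, Matrix.transpose_sub, Matrix.transpose_smul, Matrix.transpose_vecMulVec]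

theorem Qr_sq {q : Pt n} (h : Ssq s q ≠ 0) : Qr s q * Qr s q = 1 := by
  have h1 : Matrix.vecMulVec (s q) (s q) * Matrix.vecMulVec (s q) (s q)
      = Ssq s q • Matrix.vecMulVec (s q) (s q) := by
    ext i j
    simp only [Matrix.mul_apply, Matrix.vecMulVec_apply, Matrix.smul_apply, Ssq, Finset.sum_mul,
      smul_eq_mul]
    exact Finset.sum_congr rfl fun k _ => by ring
  have h2 : Qr s q * Qr s q = 1 - (2 / Ssq s q) • Matrix.vecMulVec (s q) (s q)
      - (2 / Ssq s q) • Matrix.vecMulVec (s q) (s q)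
      + (2 / Ssq s q) • (2 / Ssq s q) •
        (Matrix.vecMulVec (s q) (s q) * Matrix.vecMulVec (s q) (s q)) := by
    simp only [Qr, Matrix.sub_mul, Matrix.mul_sub, Matrix.one_mul, Matrix.mul_one,
      Matrix.smul_mul, Matrix.mul_smul, smul_sub]
    abel
  rw [h2, h1]
  ext i j
  simp only [Matrix.sub_apply, Matrix.add_apply, Matrix.smul_apply, smul_eq_mul]
  field_simp
  ring

theorem Qr_mul (q : Pt n) (M : Mat n) (a j : Fin n) :
    (Qr s q * M) a j = M a j - 2 / Ssq s q * s q a * ∑ b, s q b * M b j := by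
  rw [Qr, Matrix.sub_mul, Matrix.one_mul, Matrix.sub_apply, Matrix.smul_mul, Matrix.smul_apply,
    Matrix.mul_apply, smul_eq_mul]
  simp only [Matrix.vecMulVec_apply, Finset.mul_sum]
  congr 1
  exact Finset.sum_congr rfl fun k _ => by ring

theorem Fr.Ssm (F : Fr V J σ s g) : Sm V (Ssq s) := by
  unfold Ssq
  exact Sm.sum fun a _ => (F.hs a).mul (F.hs a)

theorem Fr.pdS (F : Fr V J σ s g) {q : Pt n} (hq : q ∈ V) (j : Fin n) :
    pd j (Ssq s) q = 2 * ∑ b, s q b * pd j (fun q => s q b) q := by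
  unfold Ssq
  rw [pd_sum fun a _ => ((F.hs a).diff F.hV hq).fun_mul ((F.hs a).diff F.hV hq), Finset.mul_sum]
  refine Finset.sum_congr rfl fun a _ => ?_
  rw [pd_mul ((F.hs a).diff F.hV hq) ((F.hs a).diff F.hV hq)]
  ring

theorem Fr.L_apply (F : Fr V J σ s g) {q : Pt n} (hq : q ∈ V) (hS : Ssq s q ≠ 0) (a j : Fin n) :
    Ldual J s q a j = J q a j - 2 * pd j (fun q => s q a) q / Ssq s q
      + 4 * s q a * (∑ b, s q b * pd j (fun q => s q b) q) / Ssq s q ^ 2 := by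
  have d := (F.hs a).diff F.hV hq
  rw [Ldual, Matrix.of_apply, pd_div ((differentiableAt_const _).fun_mul d) (F.Ssm.diff F.hV hq) hS,
    pd_mul (differentiableAt_const _) d, pd_const, F.pdS hq]
  ring

theorem Fr.sB (F : Fr V J σ s g) {q : Pt n} (hq : q ∈ V) (j : Fin n) :
    ∑ b, s q b * Bt J σ s q b j
      = (∑ b, s q b * pd j (fun q => s q b) q) + 1 / 2 * Ssq s q * pd j σ q := by
  have e : ∑ b, s q b * Bt J σ s q b j = (∑ b, s q b * pd j (fun q => s q b) q)
      + pd j σ q * Ssq s q - 1 / 2 * Ssq s q * ∑ b, s q b * J q b j := by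
    have : ∀ b, Bt J σ s q b j = pd j (fun q => s q b) q + pd j σ q * s q b
        - 1 / 2 * Ssq s q * J q b j := fun b => rfl
    simp only [this]
    rw [show pd j σ q * Ssq s q = ∑ b, pd j σ q * (s q b * s q b) by rw [Ssq, Finset.mul_sum],
      Finset.mul_sum, ← Finset.sum_add_distrib, ← Finset.sum_sub_distrib]
    exact Finset.sum_congr rfl fun k _ => by ring
  rw [e, ← F.sJ q hq]; ring

theorem Fr.L_eq (F : Fr V J σ s g) {q : Pt n} (hq : q ∈ V) (hS : Ssq s q ≠ 0) :
    Ldual J s q = (-2 / Ssq s q) • (Qr s q * Bt J σ s q) := by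
  ext a j
  rw [F.L_apply hq hS, Matrix.smul_apply, Qr_mul, F.sB hq, smul_eq_mul]
  have : Bt J σ s q a j = pd j (fun q => s q a) q + pd j σ q * s q a
        - 1 / 2 * Ssq s q * J q a j := rfl
  rw [this]
  field_simp
  ring

theorem Fr.L_tr (F : Fr V J σ s g) {q : Pt n} (hq : q ∈ V) (hS : Ssq s q ≠ 0) :
    (Ldual J s q)ᵀ * Ldual J s q = (4 / Ssq s q ^ 2) • ((Bt J σ s q)ᵀ * Bt J σ s q) := by
  rw [F.L_eq hq hS, Matrix.transpose_smul, Matrix.smul_mul, Matrix.mul_smul, smul_smul,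
    Matrix.transpose_mul, Qr_symm, Matrix.mul_assoc, ← Matrix.mul_assoc (Qr s q), Qr_sq hS,
    Matrix.one_mul]
  congr 1
  ring

theorem Fr.ginv (F : Fr V J σ s g) {q : Pt n} (hq : q ∈ V) :
    (g q)⁻¹ = Real.exp (2 * σ q) • ((J q)⁻¹ * ((J q)⁻¹)ᵀ) := by
  have hu : IsUnit (J q).det := isUnit_iff_ne_zero.2 (F.det q hq)
  refine Matrix.inv_eq_right_inv ?_
  rw [F.gmat hq, Matrix.smul_mul, Matrix.mul_smul, smul_smul, ← Real.exp_add]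
  have : (J q)ᵀ * J q * ((J q)⁻¹ * ((J q)⁻¹)ᵀ) = 1 := by
    rw [Matrix.mul_assoc, ← Matrix.mul_assoc (J q) (J q)⁻¹, Matrix.mul_nonsing_inv _ hu,
      Matrix.one_mul, ← Matrix.transpose_mul, Matrix.nonsing_inv_mul _ hu, Matrix.transpose_one]
  rw [this]; simp

theorem Fr.bsymm' (F : Fr V J σ s g) {q : Pt n} (hq : q ∈ V) :
    (Bt J σ s q)ᵀ * J q = (J q)ᵀ * Bt J σ s q := by
  ext i j
  rw [Matrix.mul_apply, Matrix.mul_apply]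
  simp only [Matrix.transpose_apply]
  rw [F.bsymm hq]
  exact Finset.sum_congr rfl fun k _ => by ring

theorem Fr.dual_eq (F : Fr V J σ s g) {q : Pt n} (hq : q ∈ V) :
    ((Bt J σ s q)ᵀ * J q) * (g q)⁻¹ * ((Bt J σ s q)ᵀ * J q)
      = Real.exp (2 * σ q) • ((Bt J σ s q)ᵀ * Bt J σ s q) := by
  have hu : IsUnit (J q).det := isUnit_iff_ne_zero.2 (F.det q hq)
  rw [F.ginv hq, Matrix.mul_smul, Matrix.smul_mul]
  congr 1
  nth_rewrite 2 [F.bsymm' hq]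
  have h1 : J q * (J q)⁻¹ = 1 := Matrix.mul_nonsing_inv _ hu
  have h2 : ((J q)⁻¹)ᵀ * (J q)ᵀ = 1 := by rw [← Matrix.transpose_mul, h1, Matrix.transpose_one]
  calc (Bt J σ s q)ᵀ * J q * ((J q)⁻¹ * ((J q)⁻¹)ᵀ) * ((J q)ᵀ * Bt J σ s q)
      = (Bt J σ s q)ᵀ * (J q * (J q)⁻¹) * (((J q)⁻¹)ᵀ * (J q)ᵀ) * Bt J σ s q := by
        simp only [Matrix.mul_assoc]
    _ = _ := by rw [h1, h2, Matrix.mul_one, Matrix.mul_one]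

theorem Fr.tau_exp (q : Pt n) (hS : 0 < Ssq s q) :
    Real.exp (-2 * taudual σ s q) = Real.exp (2 * σ q) * Ssq s q ^ 2 / 4 := by
  have : -2 * taudual σ s q
      = 2 * σ q + (Real.log (Ssq s q) + Real.log (Ssq s q)) - (Real.log 2 + Real.log 2) := by
    rw [taudual]; ring
  rw [this, Real.exp_sub, Real.exp_add, Real.exp_add, Real.exp_add, Real.exp_log hS,
    Real.exp_log (by norm_num)]
  ring

theorem Fr.dual (F : Fr V J σ s g) (hS : ∀ q ∈ V, 0 < Ssq s q)
    (hB : ∀ q ∈ V, (Bt J σ s q).det ≠ 0) {g' : Pt n → Mat n}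
    (hg' : ∀ q ∈ V, g' q = ((Bt J σ s q)ᵀ * J q) * (g q)⁻¹ * ((Bt J σ s q)ᵀ * J q)) :
    Fr V (Ldual J s) (taudual σ s) (fun q a => - s q a) g' where
  hV := F.hV
  hJ a j := by
    have h1 : Sm V (fun q => 2 * s q a / Ssq s q) :=
      (contDiffOn_const.mul (F.hs a)).div F.Ssm fun q hq => (hS q hq).ne'
    exact (F.hJ a j).sub (h1.pd F.hV j)
  cl q hq a i j := by
    have h1 : Sm V (fun q => 2 * s q a / Ssq s q) :=
      (contDiffOn_const.mul (F.hs a)).div F.Ssm fun q hq => (hS q hq).ne'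
    simp only [Ldual, Matrix.of_apply]
    rw [pd_sub ((F.hJ a j).diff F.hV hq) ((h1.pd F.hV j).diff F.hV hq),
      pd_sub ((F.hJ a i).diff F.hV hq) ((h1.pd F.hV i).diff F.hV hq), F.cl q hq a i j,
      pd_comm h1 F.hV hq i j]
  det q hq := by
    rw [F.L_eq hq (hS q hq).ne', Matrix.det_smul, Matrix.det_mul]
    have h1 : (Qr s q).det ≠ 0 := by
      intro h
      have := congrArg Matrix.det (Qr_sq (s := s) (hS q hq).ne')
      rw [Matrix.det_mul, h, Matrix.det_one] at this
      norm_num at this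
    refine mul_ne_zero (pow_ne_zero _ (div_ne_zero (by norm_num) (hS q hq).ne'))
      (mul_ne_zero h1 (hB q hq))
  hσ := (contDiffOn_const.sub F.hσ).sub (F.Ssm.log fun q hq => (hS q hq).ne')
  hs a := (F.hs a).neg
  sJ q hq i := by
    have hS0 := (hS q hq).ne'
    have h1 : pd i (taudual σ s) q = - pd i σ q
        - 2 * (∑ b, s q b * pd i (fun q => s q b) q) / Ssq s q := by
      unfold taudual
      rw [pd_sub ((differentiableAt_const _).fun_sub (F.hσ.diff F.hV hq))
        ((F.Ssm.diff F.hV hq).log hS0), pd_sub (differentiableAt_const _) (F.hσ.diff F.hV hq),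
        pd_const, pd_log (F.Ssm.diff F.hV hq) hS0, F.pdS hq]
      ring
    have h2 : ∑ a, -s q a * Ldual J s q a i = -(∑ a, s q a * J q a i)
        + 2 * (∑ b, s q b * pd i (fun q => s q b) q) / Ssq s q
        - 4 * (∑ b, s q b * pd i (fun q => s q b) q) / Ssq s q ^ 2 * Ssq s q := by
      generalize hc : ∑ b, s q b * pd i (fun q => s q b) q = c
      have : ∀ a, -s q a * Ldual J s q a i = - (s q a * J q a i)
          + 2 / Ssq s q * (s q a * pd i (fun q => s q a) q)
          - 4 * c / Ssq s q ^ 2 * (s q a * s q a) := by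
        intro a
        rw [F.L_apply hq hS0, hc]; ring
      simp only [this]
      rw [Finset.sum_sub_distrib, Finset.sum_add_distrib, ← Finset.mul_sum, ← Finset.mul_sum, hc,
        Finset.sum_neg_distrib]
      rw [show ∑ a, s q a * s q a = Ssq s q from rfl]
      ring
    rw [h1, h2, ← F.sJ q hq]
    field_simp
    ring
  hg q hq i j := by
    have h1 : ∑ a, Ldual J s q a i * Ldual J s q a j = ((Ldual J s q)ᵀ * Ldual J s q) i j := rfl
    have hS0 := (hS q hq).ne'
    rw [h1, F.L_tr hq hS0, hg' q hq, F.dual_eq hq, Fr.tau_exp q (hS q hq), Matrix.smul_apply,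
      Matrix.smul_apply, smul_eq_mul, smul_eq_mul]
    field_simp

theorem Fr.dual_flat (F : Fr V J σ s g) :
    FlatOn (fun q => Real.exp (2 * σ q) • g q) V := by
  have F0 : Fr V J (fun _ => 0) (fun _ _ => 0) (fun q => Real.exp (2 * σ q) • g q) :=
    { hV := F.hV, hJ := F.hJ, cl := F.cl, det := F.det, hσ := contDiffOn_const,
      hs := fun a => contDiffOn_const
      sJ := fun q hq i => by rw [pd_const]; simp
      hg := fun q hq i j => by
        rw [Matrix.smul_apply, F.hg q hq, smul_eq_mul, ← mul_assoc, ← Real.exp_add]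
        congr 2
        ring }
  refine F0.flat fun q hq => ?_
  ext a i
  simp [Bt, pd_const]

theorem Fr.dual_schouten (F : Fr V J σ s g) (hS : ∀ q ∈ V, 0 < Ssq s q)
    (hB : ∀ q ∈ V, (Bt J σ s q).det ≠ 0) {g' : Pt n → Mat n}
    (hg' : ∀ q ∈ V, g' q = ((Bt J σ s q)ᵀ * J q) * (g q)⁻¹ * ((Bt J σ s q)ᵀ * J q))
    (hn : 3 ≤ n) {q : Pt n} (hq : q ∈ V) : Loc.schouten g' q = Loc.schouten g q := by
  have F' := F.dual hS hB hg'
  have hS0 := (hS q hq).ne'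
  rw [F'.schouten hn hq, F.schouten hn hq]
  have h1 : Bt (Ldual J s) (taudual σ s) (fun q a => - s q a) q
      = (- Ssq s q / 2) • (Qr s q * J q) := by
    ext a i
    rw [Matrix.smul_apply, Qr_mul, ← F.sJ q hq, smul_eq_mul]
    have e1 : pd i (taudual σ s) q = - pd i σ q
        - 2 * (∑ b, s q b * pd i (fun q => s q b) q) / Ssq s q := by
      unfold taudual
      rw [pd_sub ((differentiableAt_const _).fun_sub (F.hσ.diff F.hV hq))
        ((F.Ssm.diff F.hV hq).log hS0), pd_sub (differentiableAt_const _) (F.hσ.diff F.hV hq),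
        pd_const, pd_log (F.Ssm.diff F.hV hq) hS0, F.pdS hq]
      ring
    have e2 : ∑ b, -s q b * -s q b = Ssq s q := by simp [Ssq]
    rw [Bt, Matrix.of_apply, e1, e2, pd_neg, F.L_apply hq hS0]
    field_simp
    ring
  rw [h1, F.L_eq hq hS0, Matrix.transpose_smul, Matrix.smul_mul, Matrix.mul_smul, smul_smul,
    Matrix.transpose_mul, Qr_symm, Matrix.mul_assoc, ← Matrix.mul_assoc (Qr s q), Qr_sq hS0,
    Matrix.one_mul, F.bsymm' hq]
  have : -Ssq s q / 2 * (-2 / Ssq s q) = 1 := by field_simp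
  rw [this, one_smul]

end

end Loc

section
set_option maxSynthPendingDepth 6
open Loc

namespace Loc
open Matrix
variable {n : ℕ}

/-- Entrywise partial derivative of a matrix function. -/
def pdM (i : Fin n) (M : Pt n → Mat n) (q : Pt n) : Mat n :=
  Matrix.of fun a b => pd i (fun q => M q a b) q

theorem pdM_mul {V : Set (Pt n)} (hV : IsOpen V) {q : Pt n} (hq : q ∈ V) {M N : Pt n → Mat n}
    (hM : ∀ i j, Sm V (fun q => M q i j)) (hN : ∀ i j, Sm V (fun q => N q i j)) (i : Fin n) :
    pdM i (fun q => M q * N q) q = pdM i M q * N q + M q * pdM i N q := by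
  ext a b
  simp only [pdM, Matrix.of_apply, Matrix.add_apply, Matrix.mul_apply]
  rw [pd_sum fun c _ => ((hM a c).diff hV hq).fun_mul ((hN c b).diff hV hq),
    ← Finset.sum_add_distrib]
  exact Finset.sum_congr rfl fun c _ => by
    rw [pd_mul ((hM a c).diff hV hq) ((hN c b).diff hV hq)]

theorem Sm.mmul {V : Set (Pt n)} {M N : Pt n → Mat n}
    (hM : ∀ i j, Sm V (fun q => M q i j)) (hN : ∀ i j, Sm V (fun q => N q i j)) (i j : Fin n) :
    Sm V (fun q => (M q * N q) i j) := by
  simp only [Matrix.mul_apply]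
  exact Sm.sum fun c _ => (hM i c).mul (hN c j)

theorem pdM_transpose (M : Pt n → Mat n) (q : Pt n) (i : Fin n) :
    pdM i (fun q => (M q)ᵀ) q = (pdM i M q)ᵀ := rfl

theorem pdM_inv {V : Set (Pt n)} (hV : IsOpen V) {q : Pt n} (hq : q ∈ V) {M : Pt n → Mat n}
    (hM : ∀ i j, Sm V (fun q => M q i j)) (h0 : ∀ q ∈ V, (M q).det ≠ 0) (i : Fin n) :
    pdM i (fun q => (M q)⁻¹) q = - ((M q)⁻¹ * pdM i M q * (M q)⁻¹) := by
  have h1 := pdM_mul hV hq hM (Sm.inv hM h0) i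
  have h2 : pdM i (fun q => M q * (M q)⁻¹) q = 0 := by
    ext a b
    simp only [pdM, Matrix.of_apply, Matrix.zero_apply]
    rw [pd_congr hV hq (g := fun _ => (1 : Mat n) a b), pd_const]
    intro q hq
    rw [Matrix.mul_nonsing_inv _ (isUnit_iff_ne_zero.2 (h0 q hq))]
  rw [h2] at h1
  have h3 : (M q)⁻¹ * M q = 1 := Matrix.nonsing_inv_mul _ (isUnit_iff_ne_zero.2 (h0 q hq))
  have h4 : (M q)⁻¹ * (pdM i M q * (M q)⁻¹ + M q * pdM i (fun q => (M q)⁻¹) q) = 0 := by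
    rw [← h1, Matrix.mul_zero]
  rw [Matrix.mul_add, ← Matrix.mul_assoc, ← Matrix.mul_assoc, h3, Matrix.one_mul] at h4
  exact eq_neg_of_add_eq_zero_right h4

theorem fderiv_apply_pd (f : Pt n → ℝ) (q h : Pt n) :
    fderiv ℝ f q h = ∑ i, h i * pd i f q := by
  conv_lhs => rw [pi_eq_sum_univ' h, map_sum]
  refine Finset.sum_congr rfl fun i _ => ?_
  rw [map_smul, smul_eq_mul]
  rfl

theorem fderiv_zero_of_pd {f : Pt n → ℝ} {q : Pt n} (h : ∀ i, pd i f q = 0) :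
    fderiv ℝ f q = 0 := by
  ext v
  have := fderiv_apply_pd f q v
  simpa [h] using this

/-- Elementary tensors. -/
def Tel (i j k : Fin n) : Pt n →L[ℝ] Pt n →L[ℝ] Pt n :=
  (ContinuousLinearMap.proj i : Pt n →L[ℝ] ℝ).smulRight
    ((ContinuousLinearMap.proj k : Pt n →L[ℝ] ℝ).smulRight (Pi.single j (1 : ℝ) : Pt n))

theorem Tel_apply (i j k : Fin n) (h u : Pt n) (m : Fin n) :
    Tel i j k h u m = h i * u k * (if m = j then 1 else 0) := by
  simp [Tel, Pi.single_apply]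

/-- The connection form acting on covectors. -/
def Bcon (g : Pt n → Mat n) (x : Pt n) : Pt n →L[ℝ] Pt n →L[ℝ] Pt n :=
  ∑ i, ∑ j, ∑ k, christoffel g k i j x • Tel i j k

theorem sum_Tel (c : Fin n → Fin n → Fin n → ℝ) (h u : Pt n) (m : Fin n) :
    (∑ i, ∑ j, ∑ k, c i j k • Tel i j k) h u m = ∑ i, ∑ k, c i m k * h i * u k := by
  simp only [_root_.sum_apply, Finset.sum_apply, _root_.smul_apply,
    Pi.smul_apply, Tel_apply, smul_eq_mul]
  refine Finset.sum_congr rfl fun i _ => ?_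
  rw [Finset.sum_comm]
  refine Finset.sum_congr rfl fun k _ => ?_
  simp [mul_assoc]

theorem Bcon_apply (g : Pt n → Mat n) (x h u : Pt n) (m : Fin n) :
    Bcon g x h u m = ∑ i, ∑ k, christoffel g k i m x * h i * u k := sum_Tel _ h u m

theorem Bcon_sm {V : Set (Pt n)} (hV : IsOpen V) {g : Pt n → Mat n}
    (hg : ∀ i j, Sm V (fun q => g q i j)) (h0 : ∀ q ∈ V, (g q).det ≠ 0) :
    ContDiffOn ℝ (⊤ : ℕ∞) (Bcon g) V := by
  unfold Bcon
  exact ContDiffOn.sum fun i _ => ContDiffOn.sum fun j _ => ContDiffOn.sum fun k _ =>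
    (christoffel_sm hV hg h0 k i j).smul contDiffOn_const

theorem Bcon_fderiv {V : Set (Pt n)} (hV : IsOpen V) {g : Pt n → Mat n}
    (hg : ∀ i j, Sm V (fun q => g q i j)) (h0 : ∀ q ∈ V, (g q).det ≠ 0) {x : Pt n} (hx : x ∈ V)
    (h k u : Pt n) (m : Fin n) :
    fderiv ℝ (Bcon g) x h k u m
      = ∑ j, ∑ l, (∑ i, h i * pd i (christoffel g l j m) x) * k j * u l := by
  have hB := (Bcon_sm hV hg h0).contDiffAt (hV.mem_nhds hx) |>.differentiableAt (by simp)
  have hc : ∀ l i j, DifferentiableAt ℝ (christoffel g l i j) x := fun l i j =>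
    (christoffel_sm hV hg h0 l i j).diff hV hx
  let ev : (Pt n →L[ℝ] Pt n →L[ℝ] Pt n) →L[ℝ] ℝ :=
    (ContinuousLinearMap.proj m).comp ((ContinuousLinearMap.apply ℝ (Pt n) u).comp
      (ContinuousLinearMap.apply ℝ (Pt n →L[ℝ] Pt n) k))
  have h1 : fderiv ℝ (Bcon g) x h k u m = fderiv ℝ (fun x => Bcon g x k u m) x h := by
    have : HasFDerivAt (fun x => ev (Bcon g x)) (ev.comp (fderiv ℝ (Bcon g) x)) x :=
      ev.hasFDerivAt.comp x hB.hasFDerivAt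
    have e : (fun x => Bcon g x k u m) = fun x => ev (Bcon g x) := rfl
    rw [e, this.fderiv]
    rfl
  rw [h1, fderiv_apply_pd]
  simp only [Bcon_apply]
  have h2 : ∀ i, pd i (fun x => ∑ j, ∑ l, christoffel g l j m x * k j * u l) x
      = ∑ j, ∑ l, pd i (christoffel g l j m) x * k j * u l := by
    intro i
    rw [pd_sum fun j _ => DifferentiableAt.fun_sum fun l _ =>
      ((hc l j m).mul_const (k j)).mul_const (u l)]
    refine Finset.sum_congr rfl fun j _ => ?_
    rw [pd_sum fun l _ => ((hc l j m).mul_const (k j)).mul_const (u l)]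
    refine Finset.sum_congr rfl fun l _ => ?_
    rw [pd_mul ((hc l j m).mul_const (k j)) (differentiableAt_const _),
      pd_mul (hc l j m) (differentiableAt_const _), pd_const, pd_const]
    ring
  simp only [h2, Finset.mul_sum, Finset.sum_mul]
  rw [Finset.sum_comm]
  refine Finset.sum_congr rfl fun j _ => ?_
  rw [Finset.sum_comm]
  refine Finset.sum_congr rfl fun l _ => Finset.sum_congr rfl fun i _ => ?_
  ring

theorem Bcon_int {V : Set (Pt n)} (hV : IsOpen V) {g : Pt n → Mat n}
    (hg : ∀ i j, Sm V (fun q => g q i j)) (h0 : ∀ q ∈ V, (g q).det ≠ 0) (hf : FlatOn g V)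
    {x : Pt n} (hx : x ∈ V) (h k u : Pt n) :
    fderiv ℝ (Bcon g) x h k u + Bcon g x k (Bcon g x h u)
      = fderiv ℝ (Bcon g) x k h u + Bcon g x h (Bcon g x k u) := by
  have key : ∀ (h k : Pt n) (m : Fin n),
      (fderiv ℝ (Bcon g) x h k u + Bcon g x k (Bcon g x h u)) m
      = ∑ i, ∑ j, h i * k j * ∑ l, u l * (pd i (christoffel g l j m) x
          + ∑ r, christoffel g l i r x * christoffel g r j m x) := by
    intro h k m
    rw [Pi.add_apply, Bcon_fderiv hV hg h0 hx, Bcon_apply]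
    simp only [Bcon_apply]
    have e1 : ∑ j, ∑ l, (∑ i, h i * pd i (christoffel g l j m) x) * k j * u l
        = ∑ i, ∑ j, ∑ l, h i * k j * (u l * pd i (christoffel g l j m) x) := by
      rw [Finset.sum_comm (s := Finset.univ) (t := Finset.univ)
        (f := fun i j => ∑ l, h i * k j * (u l * pd i (christoffel g l j m) x))]
      refine Finset.sum_congr rfl fun j _ => ?_
      simp only [Finset.sum_mul]
      rw [Finset.sum_comm]
      refine Finset.sum_congr rfl fun i _ => Finset.sum_congr rfl fun l _ => ?_
      ring
    have e2 : ∑ j, ∑ r, christoffel g r j m x * k j *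
          (∑ i, ∑ l, christoffel g l i r x * h i * u l)
        = ∑ i, ∑ j, ∑ l, h i * k j * (u l *
            ∑ r, christoffel g l i r x * christoffel g r j m x) := by
      rw [Finset.sum_comm (s := Finset.univ) (t := Finset.univ)
        (f := fun i j => ∑ l, h i * k j * (u l *
            ∑ r, christoffel g l i r x * christoffel g r j m x))]
      refine Finset.sum_congr rfl fun j _ => ?_
      simp only [Finset.mul_sum]
      rw [Finset.sum_comm]
      refine Finset.sum_congr rfl fun i _ => ?_
      rw [Finset.sum_comm]
      refine Finset.sum_congr rfl fun l _ => Finset.sum_congr rfl fun r _ => ?_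
      ring
    rw [e1, e2]
    simp only [← Finset.sum_add_distrib, Finset.mul_sum, mul_add]
  ext m
  rw [key, key, Finset.sum_comm]
  refine Finset.sum_congr rfl fun j _ => Finset.sum_congr rfl fun i _ => ?_
  rw [mul_comm (h i)]
  congr 1
  refine Finset.sum_congr rfl fun l _ => ?_
  have := hf x hx l i j m
  unfold riemann at this
  rw [Finset.sum_sub_distrib] at this
  congr 1
  linarith

end Loc

open Loc

namespace Loc
open Matrix
variable {n : ℕ}

open scoped MatrixOrder in
theorem exists_sqrt {G : Mat n} (h : G.PosDef) : ∃ J : Mat n, G = Jᵀ * J := by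
  obtain ⟨B, hB⟩ := CStarAlgebra.nonneg_iff_eq_star_mul_self.mp h.posSemidef.nonneg
  exact ⟨B, by rw [hB, Matrix.star_eq_conjTranspose, Matrix.conjTranspose_eq_transpose_of_trivial]⟩

/-- Christoffel matrices. -/
def Gam (g : Pt n → Mat n) (i : Fin n) (q : Pt n) : Mat n :=
  Matrix.of fun k j => christoffel g k i j q

theorem pdM_metric {V : Set (Pt n)} (hV : IsOpen V) {g : Pt n → Mat n}
    (h0 : ∀ q ∈ V, (g q).det ≠ 0)
    (hsy : ∀ q ∈ V, (g q).IsSymm) {q : Pt n} (hq : q ∈ V) (i : Fin n) :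
    pdM i g q = (Gam g i q)ᵀ * g q + g q * Gam g i q := by
  ext a b
  have s1 : ∀ q ∈ V, ∀ a b, g q a b = g q b a := fun q hq a b => (hsy q hq).apply b a
  have s2 : ∀ m a b, pd m (fun q => g q a b) q = pd m (fun q => g q b a) q := fun m a b =>
    pd_congr hV hq (fun q hq => s1 q hq a b) m
  have l1 := christoffel_lower g (h0 q hq) b i a
  have l2 := christoffel_lower g (h0 q hq) a i b
  have e1 : ((Gam g i q)ᵀ * g q) a b = ∑ k, g q b k * christoffel g k i a q := by
    rw [Matrix.mul_apply]
    exact Finset.sum_congr rfl fun k _ => by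
      rw [s1 q hq b k, mul_comm]; rfl
  have e2 : (g q * Gam g i q) a b = ∑ k, g q a k * christoffel g k i b q := rfl
  rw [Matrix.add_apply, e1, e2, l1, l2, s2 i b a]
  simp only [pdM, Matrix.of_apply]
  ring

theorem christoffel_symm {V : Set (Pt n)} (hV : IsOpen V) {g : Pt n → Mat n}
    (hsy : ∀ q ∈ V, (g q).IsSymm) {q : Pt n} (hq : q ∈ V) (k i j : Fin n) :
    christoffel g k i j q = christoffel g k j i q := by
  unfold christoffel
  congr 1
  refine Finset.sum_congr rfl fun l _ => ?_
  rw [pd_congr hV hq (fun q hq => (hsy q hq).apply j i) l]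
  ring

theorem const_of_pd {p : Pt n} {r : ℝ} {f : Pt n → ℝ}
    (hf : Sm (Metric.ball p r) f) (h : ∀ q ∈ Metric.ball p r, ∀ i, pd i f q = 0)
    {q : Pt n} (hq : q ∈ Metric.ball p r) : f q = f p := by
  have hp : p ∈ Metric.ball p r := Metric.mem_ball_self (Metric.pos_of_mem_ball hq)
  refine (convex_ball p r).is_const_of_fderivWithin_eq_zero (𝕜 := ℝ)
    (hf.differentiableOn (by simp)) (fun x hx => ?_) hq hp
  rw [fderivWithin_of_isOpen Metric.isOpen_ball hx]
  exact fderiv_zero_of_pd (h x hx)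

theorem smooth_of_pd {V : Set (Pt n)} (hV : IsOpen V) {g : Pt n → Mat n}
    (hc : ∀ k i j, Sm V (christoffel g k i j)) {u : Pt n → Pt n}
    (hu : ∀ x ∈ V, HasFDerivAt u ((Bcon g x).flip (u x)) x) : ContDiffOn ℝ (⊤ : ℕ∞) u V := by
  have hd : DifferentiableOn ℝ u V := fun x hx => (hu x hx).differentiableAt.differentiableWithinAt
  refine contDiffOn_infty.2 fun m => ?_
  induction m with
  | zero => exact contDiffOn_zero.2 hd.continuousOn
  | succ m ih =>
    have : ((m + 1 : ℕ) : WithTop ℕ∞) = (m : WithTop ℕ∞) + 1 := by push_cast; rfl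
    rw [this, contDiffOn_succ_iff_fderiv_of_isOpen hV]
    refine ⟨hd, fun h => by simp at h, ?_⟩
    have e : ∀ x ∈ V, fderiv ℝ u x
        = ∑ i, ∑ j, ∑ k, christoffel g k i j x • (Tel i j k).flip (u x) := by
      intro x hx
      rw [(hu x hx).fderiv]
      ext h
      simp [Bcon]
    refine ContDiffOn.congr ?_ e
    refine ContDiffOn.sum fun i _ => ContDiffOn.sum fun j _ => ContDiffOn.sum fun k _ => ?_
    exact ((hc k i j).of_le (by exact_mod_cast le_top)).smul
      (((Tel i j k).flip).contDiff.comp_contDiffOn ih)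

theorem iso {V : Set (Pt n)} (hV : IsOpen V) {g : Pt n → Mat n}
    (hg : ∀ i j, Sm V (fun q => g q i j)) (hsy : ∀ q ∈ V, (g q).IsSymm)
    (hpd : ∀ q ∈ V, (g q).PosDef) (hf : FlatOn g V) {p : Pt n} (hp : p ∈ V) :
    ∃ r > 0, Metric.ball p r ⊆ V ∧ ∃ J : Pt n → Mat n,
      (∀ a j, Sm (Metric.ball p r) (fun q => J q a j)) ∧
      (∀ q ∈ Metric.ball p r, ∀ a i j, pd i (fun q => J q a j) q = pd j (fun q => J q a i) q) ∧
      (∀ q ∈ Metric.ball p r, (J q).det ≠ 0) ∧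
      (∀ q ∈ Metric.ball p r, g q = (J q)ᵀ * J q) := by
  have h0 : ∀ q ∈ V, (g q).det ≠ 0 := fun q hq => (hpd q hq).det_pos.ne'
  obtain ⟨r, hr, hrV, hfr⟩ := frob (Bcon g) V hV (Bcon_sm hV hg h0) p hp
    (fun x hx h k u => Bcon_int hV hg h0 hf hx h k u)
  obtain ⟨J0, hJ0⟩ := exists_sqrt (hpd p hp)
  choose u hup hu using fun a => hfr (J0 a)
  set W := Metric.ball p r with hW
  have hWo : IsOpen W := Metric.isOpen_ball
  have hpW : p ∈ W := Metric.mem_ball_self hr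
  have hc : ∀ k i j, Sm W (christoffel g k i j) := fun k i j =>
    (christoffel_sm hV hg h0 k i j).mono hrV
  have husm : ∀ a, ContDiffOn ℝ (⊤ : ℕ∞) (u a) W := fun a => smooth_of_pd hWo hc (hu a)
  set J : Pt n → Mat n := fun q => Matrix.of fun a j => u a q j with hJ
  have hJs : ∀ a j, Sm W (fun q => J q a j) := fun a j => contDiffOn_pi.1 (husm a) j
  have hJpd : ∀ q ∈ W, ∀ i a j, pd i (fun q => J q a j) q
      = ∑ k, J q a k * christoffel g k i j q := by
    intro q hq i a j
    have h1 := hasFDerivAt_pi'.1 (hu a q hq) j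
    have : pd i (fun q => J q a j) q = (Bcon g q).flip (u a q) (Pi.single i 1) j := by
      unfold pd
      rw [show (fun q => J q a j) = fun q => u a q j from rfl, h1.fderiv]
      rfl
    rw [this, ContinuousLinearMap.flip_apply, Bcon_apply, Finset.sum_comm]
    refine Finset.sum_congr rfl fun k _ => ?_
    simp [Pi.single_apply, hJ]
    ring
  have hJM : ∀ q ∈ W, ∀ i, pdM i J q = J q * Gam g i q := by
    intro q hq i
    ext a j
    exact hJpd q hq i a j
  have hgW : ∀ i j, Sm W (fun q => g q i j) := fun i j => (hg i j).mono hrV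
  have h0W : ∀ q ∈ W, (g q).det ≠ 0 := fun q hq => h0 q (hrV hq)
  have hK := Sm.inv hgW h0W
  have hJt : ∀ a j, Sm W (fun q => (J q)ᵀ a j) := fun a j => hJs j a
  have hJK := Sm.mmul hJs hK
  have hz : ∀ q ∈ W, ∀ i, pdM i (fun q => J q * (g q)⁻¹ * (J q)ᵀ) q = 0 := by
    intro q hq i
    have u1 : (g q)⁻¹ * g q = 1 := Matrix.nonsing_inv_mul _ (isUnit_iff_ne_zero.2 (h0W q hq))
    have u2 : g q * (g q)⁻¹ = 1 := Matrix.mul_nonsing_inv _ (isUnit_iff_ne_zero.2 (h0W q hq))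
    rw [pdM_mul hWo hq hJK hJt, pdM_mul hWo hq hJs hK, pdM_inv hWo hq hgW h0W, pdM_transpose,
      hJM q hq, pdM_metric hV h0 hsy (hrV hq), Matrix.transpose_mul]
    have e : (g q)⁻¹ * ((Gam g i q)ᵀ * g q + g q * Gam g i q) * (g q)⁻¹
        = (g q)⁻¹ * (Gam g i q)ᵀ + Gam g i q * (g q)⁻¹ := by
      rw [Matrix.mul_add, Matrix.add_mul, ← Matrix.mul_assoc, Matrix.mul_assoc _ (g q), u2,
        Matrix.mul_one, ← Matrix.mul_assoc (g q)⁻¹ (g q), u1, Matrix.one_mul]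
    rw [e]
    noncomm_ring
  have hcon : ∀ q ∈ W, J q * (g q)⁻¹ * (J q)ᵀ = 1 := by
    intro q hq
    have h1 : J q * (g q)⁻¹ * (J q)ᵀ = J p * (g p)⁻¹ * (J p)ᵀ := by
      ext a b
      refine const_of_pd (f := fun q => (J q * (g q)⁻¹ * (J q)ᵀ) a b)
        (Sm.mmul hJK hJt a b) (fun x hx i => ?_) hq
      exact congrFun (congrFun (hz x hx i) a) b
    have h2 : J p = J0 := by
      ext a j
      exact congrFun (hup a) j
    rw [h1, h2, Matrix.mul_assoc, mul_eq_one_comm, Matrix.mul_assoc, ← hJ0]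
    exact Matrix.nonsing_inv_mul _ (isUnit_iff_ne_zero.2 (h0 p hp))
  refine ⟨r, hr, hrV, J, hJs, ?_, ?_, ?_⟩
  · intro q hq a i j
    rw [hJpd q hq, hJpd q hq]
    exact Finset.sum_congr rfl fun k _ => by rw [christoffel_symm hV hsy (hrV hq)]
  · intro q hq h
    have := congrArg Matrix.det (hcon q hq)
    rw [Matrix.det_mul, Matrix.det_mul, h] at this
    simp at this
  · intro q hq
    have h1 := hcon q hq
    rw [Matrix.mul_assoc, mul_eq_one_comm, Matrix.mul_assoc] at h1
    have u2 : g q * (g q)⁻¹ = 1 := Matrix.mul_nonsing_inv _ (isUnit_iff_ne_zero.2 (h0W q hq))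
    calc g q = g q * ((g q)⁻¹ * ((J q)ᵀ * J q)) := by rw [h1, Matrix.mul_one]
      _ = _ := by rw [← Matrix.mul_assoc, u2, Matrix.one_mul]

end Loc

open Loc

namespace Loc
open Matrix
variable {n : ℕ}

theorem mkFr {V : Set (Pt n)} {J : Pt n → Mat n} {σ : Pt n → ℝ} {g : Pt n → Mat n}
    (hV : IsOpen V) (hJ : ∀ a j, Sm V (fun q => J q a j))
    (cl : ∀ q ∈ V, ∀ a i j, pd i (fun q => J q a j) q = pd j (fun q => J q a i) q)
    (det : ∀ q ∈ V, (J q).det ≠ 0) (hσ : Sm V σ)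
    (hg : ∀ q ∈ V, g q = Real.exp (-2 * σ q) • ((J q)ᵀ * J q))
    {p : Pt n} (hp : p ∈ V) {i : Fin n} (hi : pd i σ p ≠ 0) :
    ∃ s, Fr V J σ s g ∧ Ssq s p ≠ 0 := by
  set s : Pt n → Fin n → ℝ := fun q a => ∑ i, pd i σ q * (J q)⁻¹ i a with hs
  have hsJ : ∀ q ∈ V, ∀ i, pd i σ q = ∑ a, s q a * J q a i := by
    intro q hq i
    have h1 : (s q) ᵥ* (J q) = fun i => pd i σ q := by
      have : s q = (fun i => pd i σ q) ᵥ* (J q)⁻¹ := rfl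
      rw [this, Matrix.vecMul_vecMul,
        Matrix.nonsing_inv_mul _ (isUnit_iff_ne_zero.2 (det q hq)), Matrix.vecMul_one]
    exact (congrFun h1 i).symm
  refine ⟨s, ⟨hV, hJ, cl, det, hσ, fun a => ?_, hsJ, fun q hq i j => ?_⟩, fun h => ?_⟩
  · exact Sm.sum fun i _ => (hσ.pd hV i).mul (Sm.inv hJ det i a)
  · rw [hg q hq, Matrix.smul_apply, Matrix.mul_apply]; rfl
  · have h1 : ∀ b, s p b = 0 := by
      intro b
      have := (Finset.sum_eq_zero_iff_of_nonneg fun b _ => mul_self_nonneg (s p b)).1 h b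
        (Finset.mem_univ b)
      exact mul_self_eq_zero.1 this
    exact hi (by rw [hsJ p hp i]; simp [h1])

theorem exists_prim {p : Pt n} {r : ℝ} {w : Pt n → Fin n → ℝ}
    (hw : ∀ j, Sm (Metric.ball p r) (fun q => w q j))
    (cl : ∀ q ∈ Metric.ball p r, ∀ i j, pd i (fun q => w q j) q = pd j (fun q => w q i) q) (c : ℝ) :
    ∃ y : Pt n → ℝ, y p = c ∧ Sm (Metric.ball p r) y ∧
      ∀ q ∈ Metric.ball p r, ∀ i, pd i y q = w q i := by
  set ω : Pt n → Pt n →L[ℝ] ℝ := fun q => ∑ i, w q i • (ContinuousLinearMap.proj i : Pt n →L[ℝ] ℝ)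
    with hω
  have hωs : ContDiffOn ℝ (⊤ : ℕ∞) ω (Metric.ball p r) :=
    ContDiffOn.sum fun i _ => (hw i).smul contDiffOn_const
  have happ : ∀ q k, ω q k = ∑ i, w q i * k i := by
    intro q k
    simp [hω]
  have hfd : ∀ q ∈ Metric.ball p r, ∀ h k, fderiv ℝ ω q h k
      = ∑ i, h i * ∑ j, pd i (fun q => w q j) q * k j := by
    intro q hq h k
    have hd : DifferentiableAt ℝ ω q :=
      (hωs.contDiffAt (Metric.isOpen_ball.mem_nhds hq)).differentiableAt (by simp)
    have h1 : HasFDerivAt (fun q => ω q k)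
        ((ContinuousLinearMap.apply ℝ ℝ k).comp (fderiv ℝ ω q)) q :=
      (ContinuousLinearMap.apply ℝ ℝ k).hasFDerivAt.comp q hd.hasFDerivAt
    have h2 : fderiv ℝ ω q h k = fderiv ℝ (fun q => ω q k) q h := by
      rw [h1.fderiv]; rfl
    rw [h2, fderiv_apply_pd]
    refine Finset.sum_congr rfl fun i _ => ?_
    simp only [happ]
    have hwd : ∀ j, DifferentiableAt ℝ (fun q => w q j) q := fun j =>
      (hw j).diff Metric.isOpen_ball hq
    rw [pd_sum fun j _ => (hwd j).mul_const (k j)]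
    congr 1
    refine Finset.sum_congr rfl fun j _ => ?_
    rw [pd_mul (hwd j) (differentiableAt_const _), pd_const]
    ring
  obtain ⟨f, hf⟩ := (convex_ball p r).exists_forall_hasFDerivAt_of_fderiv_symmetric
    Metric.isOpen_ball (hωs.differentiableOn (by simp)) (by
      intro q hq h k
      rw [hfd q hq, hfd q hq]
      simp only [Finset.mul_sum]
      rw [Finset.sum_comm]
      refine Finset.sum_congr rfl fun i _ => Finset.sum_congr rfl fun j _ => ?_
      rw [cl q hq]
      ring)
  have hfs : Sm (Metric.ball p r) f := by
    refine (contDiffOn_infty_iff_fderiv_of_isOpen Metric.isOpen_ball).2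
      ⟨fun q hq => (hf q hq).differentiableAt.differentiableWithinAt, ?_⟩
    exact hωs.congr fun q hq => (hf q hq).fderiv
  refine ⟨fun q => f q - f p + c, by simp, (hfs.sub contDiffOn_const).add contDiffOn_const, ?_⟩
  intro q hq i
  have hd := (hf q hq).differentiableAt
  rw [pd_add (hd.fun_sub (differentiableAt_const _)) (differentiableAt_const _),
    pd_sub hd (differentiableAt_const _), pd_const, pd_const]
  have : pd i f q = w q i := by
    unfold pd
    rw [(hf q hq).fderiv, happ]
    simp [Pi.single_apply]
  rw [this]; ring

theorem good_frame {p : Pt n} {r : ℝ} (hr : 0 < r) (hn : 3 ≤ n) {J : Pt n → Mat n} {σ : Pt n → ℝ}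
    {g : Pt n → Mat n} (hJ : ∀ a j, Sm (Metric.ball p r) (fun q => J q a j))
    (cl : ∀ q ∈ Metric.ball p r, ∀ a i j, pd i (fun q => J q a j) q = pd j (fun q => J q a i) q)
    (det : ∀ q ∈ Metric.ball p r, (J q).det ≠ 0) (hσ : Sm (Metric.ball p r) σ)
    (hg : ∀ q ∈ Metric.ball p r, g q = Real.exp (-2 * σ q) • ((J q)ᵀ * J q)) :
    ∃ V J' σ' s, p ∈ V ∧ V ⊆ Metric.ball p r ∧ Fr V J' σ' s g ∧ Ssq s p ≠ 0 := by
  have hpb : p ∈ Metric.ball p r := Metric.mem_ball_self hr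
  by_cases hz : ∃ i, pd i σ p ≠ 0
  · obtain ⟨i, hi⟩ := hz
    obtain ⟨s, F, hs⟩ := mkFr Metric.isOpen_ball hJ cl det hσ hg hpb hi
    exact ⟨_, J, σ, s, hpb, subset_rfl, F, hs⟩
  push Not at hz
  let a0 : Fin n := ⟨0, by omega⟩
  choose y' hyp hys hypd using fun a : Fin n => exists_prim (w := fun q j => J q a j) (hJ a)
    (fun q hq i j => cl q hq a i j) (if a = a0 then 1 else 0)
  set y : Pt n → Fin n → ℝ := fun q a => y' a q with hy
  have hSs : Sm (Metric.ball p r) (Ssq y) := by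
    unfold Ssq
    exact Sm.sum fun a _ => (hys a).mul (hys a)
  have hSpd : ∀ q ∈ Metric.ball p r, ∀ j, pd j (Ssq y) q = 2 * ∑ b, y q b * J q b j := by
    intro q hq j
    have hd : ∀ a, DifferentiableAt ℝ (fun q => y q a) q := fun a =>
      (hys a).diff Metric.isOpen_ball hq
    unfold Ssq
    rw [pd_sum fun a _ => (hd a).fun_mul (hd a), Finset.mul_sum]
    refine Finset.sum_congr rfl fun a _ => ?_
    rw [pd_mul (hd a) (hd a), hypd a q hq j]
    ring
  have hS1 : Ssq y p = 1 := by
    simp [Ssq, hy, hyp]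
  set V := Metric.ball p r ∩ Ssq y ⁻¹' Set.Ioi 0 with hV
  have hVo : IsOpen V := hSs.continuousOn.isOpen_inter_preimage Metric.isOpen_ball isOpen_Ioi
  have hVb : V ⊆ Metric.ball p r := Set.inter_subset_left
  have hpV : p ∈ V := ⟨hpb, by simp [hS1]⟩
  have hpos : ∀ q ∈ V, 0 < Ssq y q := fun q hq => hq.2
  have hfs : ∀ a, Sm V (fun q => y q a / Ssq y q) := fun a =>
    ((hys a).mono hVb).div (hSs.mono hVb) fun q hq => (hpos q hq).ne'
  set J' : Pt n → Mat n := fun q => Matrix.of fun a j => pd j (fun q => y q a / Ssq y q) q with hJ'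
  have hJ'eq : ∀ q ∈ V, J' q = (1 / Ssq y q) • (Qr y q * J q) := by
    intro q hq
    have h0 := (hpos q hq).ne'
    ext a j
    rw [Matrix.smul_apply, Qr_mul]
    simp only [hJ', Matrix.of_apply, smul_eq_mul]
    rw [pd_div ((hys a).diff Metric.isOpen_ball (hVb hq)) (hSs.diff Metric.isOpen_ball (hVb hq)) h0,
      hSpd q (hVb hq), hypd a q (hVb hq) j, show y' a q = y q a from rfl]
    field_simp
  have hdQ : ∀ q ∈ V, (Qr y q).det ≠ 0 := by
    intro q hq h
    have := congrArg Matrix.det (Qr_sq (hpos q hq).ne')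
    rw [Matrix.det_mul, h] at this
    simp at this
  have hσ' : Sm V (fun q => σ q - Real.log (Ssq y q)) :=
    (hσ.mono hVb).sub ((hSs.mono hVb).log fun q hq => (hpos q hq).ne')
  have hex : ∃ i, J p a0 i ≠ 0 := by
    by_contra hc
    push Not at hc
    exact det p hpb (Matrix.det_eq_zero_of_row_eq_zero a0 hc)
  obtain ⟨i, hi⟩ := hex
  obtain ⟨s, F, hs⟩ := mkFr (g := g) (J := J') (σ := fun q => σ q - Real.log (Ssq y q)) (p := p)
    (i := i) hVo (fun a j => (hfs a).pd hVo j) (fun q hq a i j => pd_comm (hfs a) hVo hq i j)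
    (fun q hq => by
      rw [hJ'eq q hq, Matrix.det_smul, Matrix.det_mul]
      have h1 := hdQ q hq
      have h2 := det q (hVb hq)
      have h3 := hpos q hq
      positivity)
    hσ'
    (fun q hq => by
      have h3 := hpos q hq
      have e : Real.exp (-2 * (σ q - Real.log (Ssq y q)))
          = Real.exp (-2 * σ q) * (Ssq y q * Ssq y q) := by
        rw [show -2 * (σ q - Real.log (Ssq y q))
          = -2 * σ q + (Real.log (Ssq y q) + Real.log (Ssq y q)) by ring, Real.exp_add,
          Real.exp_add, Real.exp_log h3]
      have e2 : (J' q)ᵀ * J' q = (1 / Ssq y q * (1 / Ssq y q)) • ((J q)ᵀ * J q) := by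
        rw [hJ'eq q hq, Matrix.transpose_smul, Matrix.transpose_mul, Qr_symm, Matrix.smul_mul,
          Matrix.mul_smul, smul_smul, Matrix.mul_assoc, ← Matrix.mul_assoc (Qr y q), Qr_sq h3.ne',
          Matrix.one_mul]
      rw [e, e2, smul_smul, hg q (hVb hq)]
      congr 1
      field_simp)
    hpV
    (by
      have hSd := hSs.diff Metric.isOpen_ball hpb
      have hl : DifferentiableAt ℝ (fun q => Real.log (Ssq y q)) p :=
        hSd.log (by rw [hS1]; exact one_ne_zero)
      rw [pd_sub (hσ.diff Metric.isOpen_ball hpb) hl,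
        pd_log hSd (by rw [hS1]; exact one_ne_zero), hz i, hSpd p hpb, hS1]
      have : ∑ b, y p b * J p b i = J p a0 i := by
        simp [hy, hyp]
      rw [this]
      simpa using hi)
  exact ⟨V, J', _, s, hpV, hVb, F, hs⟩

section
variable (d : CTB n)

theorem reg_open (h : d.IsCTB) : IsOpen d.reg := by
  have : d.reg = d.U ∩ (fun q => (d.φ q).det) ⁻¹' {0}ᶜ := rfl
  rw [this]
  exact (Sm.det (M := d.φ) h.2.2.2.2.2.1).continuousOn.isOpen_inter_preimage h.1
    isOpen_compl_singleton

theorem gmet_sm (h : d.IsCTB) (i j : Fin n) : Sm d.U (fun q => d.gmet q i j) :=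
  Sm.mmul (M := fun q => (d.φ q)ᵀ * d.h q) (N := d.φ)
    (Sm.mmul (M := fun q => (d.φ q)ᵀ) (fun a b => h.2.2.2.2.2.1 b a) h.2.1) h.2.2.2.2.2.1 i j

theorem gmet_symm (h : d.IsCTB) {q : Pt n} (hq : q ∈ d.U) : (d.gmet q).IsSymm := by
  have := (h.2.2.1 q hq).1
  unfold CTB.gmet Matrix.IsSymm
  rw [Matrix.transpose_mul, Matrix.transpose_mul, Matrix.transpose_transpose, this.eq,
    Matrix.mul_assoc]

theorem posDef_conj {M P : Mat n} (hM : M.PosDef) (hP : P.det ≠ 0) : (Pᵀ * M * P).PosDef := by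
  have := hM.conjTranspose_mul_mul_same (B := P)
    (Matrix.mulVec_injective_iff_isUnit.2 ((Matrix.isUnit_iff_isUnit_det _).2
      (isUnit_iff_ne_zero.2 hP)))
  rwa [Matrix.conjTranspose_eq_transpose_of_trivial] at this

theorem gmet_pos (h : d.IsCTB) {q : Pt n} (hq : q ∈ d.reg) : (d.gmet q).PosDef :=
  posDef_conj (h.2.2.1 q hq.1).2 hq.2

theorem local_frame (h : d.IsGCF) {p : Pt n} (hp : p ∈ d.regStar) :
    ∃ V J σ s, p ∈ V ∧ V ⊆ d.regStar ∧ Fr V J σ s d.gmet ∧ (∀ q ∈ V, 0 < Ssq s q) ∧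
      ∀ q ∈ V, (Bt J σ s q).det ≠ 0 := by
  obtain ⟨hn, hC, -, hcf⟩ := h
  obtain ⟨V0, hV0, hpV0, hV0r, σ, hσ, hflat⟩ := hcf p hp.1
  have hU : V0 ⊆ d.U := fun q hq => (hV0r hq).1
  obtain ⟨r, hr, hrV, J, hJ, cl, det, hJJ⟩ := iso hV0
    (g := fun q => Real.exp (2 * σ q) • d.gmet q)
    (fun i j => (ContDiffOn.exp (contDiffOn_const.mul hσ)).mul ((gmet_sm d hC i j).mono hU))
    (fun q hq => (gmet_symm d hC (hU hq)).smul _)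
    (fun q hq => (gmet_pos d hC (hV0r hq)).smul (Real.exp_pos _)) hflat hpV0
  obtain ⟨V1, J', σ', s, hpV1, hV1, F, hs⟩ := good_frame (g := d.gmet) hr hn hJ cl det
    (hσ.mono hrV) (fun q hq => by
      rw [← hJJ q hq, smul_smul, ← Real.exp_add]
      simp)
  have hBs : ∀ a j, Sm V1 (fun q => Bt J' σ' s q a j) := fun a j =>
    ((((F.hs a).pd F.hV j).add ((F.hσ.pd F.hV j).mul (F.hs a)))).sub
      ((contDiffOn_const.mul F.Ssm).mul (F.hJ a j))
  have hBd := (Sm.det hBs).continuousOn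
  have hsch : ∀ q ∈ V1, (d.schoutenT q).det = (Bt J' σ' s q).det * (J' q).det := by
    intro q hq
    unfold CTB.schoutenT
    rw [F.schouten hn hq, Matrix.det_mul, Matrix.det_transpose]
  set V2 := V1 ∩ Ssq s ⁻¹' {0}ᶜ
  have hV2 : IsOpen V2 := F.Ssm.continuousOn.isOpen_inter_preimage F.hV isOpen_compl_singleton
  set V := V2 ∩ (fun q => (Bt J' σ' s q).det) ⁻¹' {0}ᶜ
  have hV21 : V2 ⊆ V1 := Set.inter_subset_left
  have hV : IsOpen V := (hBd.mono hV21).isOpen_inter_preimage hV2 isOpen_compl_singleton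
  have hVV1 : V ⊆ V1 := fun q hq => hq.1.1
  refine ⟨V, J', σ', s, ⟨⟨hpV1, hs⟩, ?_⟩, ?_, ?_, ?_, ?_⟩
  · intro h0
    have h0 : (Bt J' σ' s p).det = 0 := h0
    exact hp.2 (by rw [hsch p hpV1, h0, zero_mul])
  · intro q hq
    refine ⟨hV0r (hrV (hV1 (hVV1 hq))), ?_⟩
    rw [hsch q (hVV1 hq)]
    exact mul_ne_zero hq.2 (F.det q (hVV1 hq))
  · exact { hV := hV, hJ := fun a j => (F.hJ a j).mono hVV1, cl := fun q hq => F.cl q (hVV1 hq),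
            det := fun q hq => F.det q (hVV1 hq), hσ := F.hσ.mono hVV1,
            hs := fun a => (F.hs a).mono hVV1, sJ := fun q hq => F.sJ q (hVV1 hq),
            hg := fun q hq => F.hg q (hVV1 hq) }
  · intro q hq
    exact lt_of_le_of_ne (Finset.sum_nonneg fun b _ => mul_self_nonneg _) (Ne.symm hq.1.2)
  · exact fun q hq => hq.2

end

end Loc


end

/-- Theorem: the dual metric: let `(Mⁿ,E,⟨,⟩,D,φ)` (`n ≥ 3`) be a
GCF-manifold with induced metric `g = φ*⟨,⟩`.  Then
`ǧ := Σ_{i,j,a,b} A_{ia} A_{jb} g^{ab} du^i ⊗ du^j` (with `A` the Schouten tensor of `g`)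
is a conformally flat Riemannian metric on the set `R*` of non-parabolic regular points,
and the Schouten tensor of `ǧ` coincides with `A`. -/
theorem statement0 {n : ℕ} (d : Loc.CTB n) (hgcf : d.IsGCF) :
    (∀ p ∈ d.regStar, (d.dualMet p).IsSymm ∧ (d.dualMet p).PosDef) ∧
    ConformallyFlatOn d.dualMet d.regStar ∧
    (∀ p ∈ d.regStar, schouten d.dualMet p = d.schoutenT p) := by
  have hn := hgcf.1
  have key : ∀ p ∈ d.regStar, ∃ V J σ s, p ∈ V ∧ V ⊆ d.regStar ∧ Fr V J σ s d.gmet ∧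
      (∀ q ∈ V, 0 < Ssq s q) ∧ (∀ q ∈ V, (Bt J σ s q).det ≠ 0) ∧
      ∀ q ∈ V, d.dualMet q
        = ((Bt J σ s q).transpose * J q) * (d.gmet q)⁻¹ * ((Bt J σ s q).transpose * J q) := by
    intro p hp
    obtain ⟨V, J, σ, s, hpV, hVr, F, hS, hB⟩ := local_frame d hgcf hp
    refine ⟨V, J, σ, s, hpV, hVr, F, hS, hB, fun q hq => ?_⟩
    unfold CTB.dualMet CTB.schoutenT
    rw [F.schouten hn hq]
  refine ⟨fun p hp => ?_, fun p hp => ?_, fun p hp => ?_⟩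
  · obtain ⟨V, J, σ, s, hpV, hVr, F, hS, hB, hD⟩ := key p hp
    rw [hD p hpV, F.dual_eq hpV]
    constructor
    · refine Matrix.IsSymm.smul ?_ _
      unfold Matrix.IsSymm
      rw [Matrix.transpose_mul, Matrix.transpose_transpose]
    · refine Matrix.PosDef.smul ?_ (Real.exp_pos _)
      have := posDef_conj (Matrix.PosDef.one (n := Fin n) (R := ℝ)) (hB p hpV)
      rwa [Matrix.mul_one] at this
  · obtain ⟨V, J, σ, s, hpV, hVr, F, hS, hB, hD⟩ := key p hp
    have F' := F.dual hS hB hD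
    exact ⟨V, F.hV, hpV, hVr, _, F'.hσ, F'.dual_flat⟩
  · obtain ⟨V, J, σ, s, hpV, hVr, F, hS, hB, hD⟩ := key p hp
    exact F.dual_schouten hS hB hD hn hpV
end
end

section
/- Let (M^n, E, ⟨,⟩, D, φ) with n ≥ 3 be a GCF-manifold with induced metric g = φ*⟨,⟩ and dual metric ǧ = Σ A_{ia} A_{jb} g^{ab} du^i ⊗ du^j on R*_M. Then at each point of R*_M the eigenvalues of the Schouten tensor of ǧ with respect to ǧ are the inverses of the eigenvalues of the Schouten tensor A of g with respect to g. -/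
noncomputable section

open Loc

/-- `μ` is an eigenvalue of the matrix `B`. -/
def IsEigenvalue {n : ℕ} (B : Loc.Mat n) (μ : ℝ) : Prop :=
  ∃ v : Fin n → ℝ, v ≠ 0 ∧ B.mulVec v = μ • v

namespace GCFAux
open Matrix

section Abs
variable {n : ℕ} {R : Type*} [CommRing R] [Algebra ℝ R] (D : Fin n → Derivation ℝ R R)

/-- entrywise derivative -/
def dM (i : Fin n) (M : Matrix (Fin n) (Fin n) R) : Matrix (Fin n) (Fin n) R := M.map (D i)

def riem (Γ : Fin n → Matrix (Fin n) (Fin n) R) (i j : Fin n) : Matrix (Fin n) (Fin n) R :=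
  dM D i (Γ j) - dM D j (Γ i) + (Γ i * Γ j - Γ j * Γ i)

def chris (hf : R) (g G : Matrix (Fin n) (Fin n) R) (i : Fin n) : Matrix (Fin n) (Fin n) R :=
  Matrix.of fun k j => hf * ∑ l, G k l * (D i (g j l) + D j (g i l) - D l (g i j))

/-- the Kulkarni-Nomizu type curvature -/
def KN (g G B : Matrix (Fin n) (Fin n) R) (i j : Fin n) : Matrix (Fin n) (Fin n) R :=
  Matrix.of fun l k => (1 : Matrix (Fin n) (Fin n) R) l i * B j k - (G * B) l j * g i k
    - ((1 : Matrix (Fin n) (Fin n) R) l j * B i k - (G * B) l i * g j k)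

lemma dM_mul (i : Fin n) (M N : Matrix (Fin n) (Fin n) R) :
    dM D i (M * N) = dM D i M * N + M * dM D i N := by
  ext a b
  simp only [dM, Matrix.map_apply, Matrix.mul_apply, map_sum, Derivation.leibniz, smul_eq_mul,
    Matrix.add_apply, ← Finset.sum_add_distrib]
  exact Finset.sum_congr rfl fun _ _ => by ring

lemma dM_add (i : Fin n) (M N : Matrix (Fin n) (Fin n) R) :
    dM D i (M + N) = dM D i M + dM D i N := by
  ext a b; simp [dM]

lemma dM_one (i : Fin n) : dM D i (1 : Matrix (Fin n) (Fin n) R) = 0 := by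
  ext a b
  simp only [dM, Matrix.map_apply, Matrix.one_apply]
  split_ifs <;> simp

lemma dM_transpose (i : Fin n) (M : Matrix (Fin n) (Fin n) R) :
    dM D i Mᵀ = (dM D i M)ᵀ := by
  ext a b; simp [dM]

lemma dM_comm (hD : ∀ i j f, D i (D j f) = D j (D i f)) (i j : Fin n)
    (M : Matrix (Fin n) (Fin n) R) : dM D i (dM D j M) = dM D j (dM D i M) := by
  ext a b; simp [dM, hD i j]

lemma dM_inv (i : Fin n) (M N : Matrix (Fin n) (Fin n) R) (h : M * N = 1) :
    dM D i N = - (N * dM D i M * N) := by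
  have h' : N * M = 1 := mul_eq_one_comm.mp h
  have := congrArg (dM D i) h
  rw [dM_mul, dM_one] at this
  have h2 : N * (dM D i M * N + M * dM D i N) = 0 := by rw [this, mul_zero]
  rw [mul_add, ← mul_assoc, ← mul_assoc, h', one_mul] at h2
  exact eq_neg_of_add_eq_zero_right h2

lemma mul_chris (hf : R) (g G : Matrix (Fin n) (Fin n) R) (hgG : g * G = 1) (i a j : Fin n) :
    (g * chris D hf g G i) a j = hf * (D i (g j a) + D j (g i a) - D a (g i j)) := by
  have e : chris D hf g G i = hf • (G * Matrix.of fun l j => (D i (g j l) + D j (g i l) - D l (g i j))) := by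
    ext k j
    simp [chris, Matrix.mul_apply]
  rw [e, Matrix.mul_smul, ← mul_assoc, hgG, one_mul]
  simp

lemma chris_compat (hf : R) (h2 : hf + hf = 1) (g G : Matrix (Fin n) (Fin n) R) (hgG : g * G = 1)
    (hg : gᵀ = g) (i : Fin n) :
    dM D i g = g * chris D hf g G i + (chris D hf g G i)ᵀ * g := by
  have hs : ∀ a b, g a b = g b a := fun a b => by conv_lhs => rw [← hg, Matrix.transpose_apply]
  ext a b
  have e : ((chris D hf g G i)ᵀ * g) a b = (g * chris D hf g G i) b a := by
    rw [← Matrix.transpose_apply (g * _), Matrix.transpose_mul, hg]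
  rw [Matrix.add_apply, e, mul_chris D hf g G hgG, mul_chris D hf g G hgG, hs b a, hs i b, hs i a]
  simp only [dM, Matrix.map_apply]
  linear_combination (-D i (g a b)) * h2

lemma chris_torsion (hf : R) (g G : Matrix (Fin n) (Fin n) R)
    (hg : gᵀ = g) (i l j : Fin n) : chris D hf g G i l j = chris D hf g G j l i := by
  have hs : ∀ a b, g a b = g b a := fun a b => by conv_lhs => rw [← hg, Matrix.transpose_apply]
  simp only [chris, Matrix.of_apply]
  congr 1
  refine Finset.sum_congr rfl fun m _ => ?_
  rw [hs i j]; ring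

lemma chris_unique (hf : R) (h2 : hf + hf = 1) (g G : Matrix (Fin n) (Fin n) R) (hgG : g * G = 1)
    (hg : gᵀ = g) (Γ : Fin n → Matrix (Fin n) (Fin n) R)
    (hc : ∀ i, dM D i g = g * Γ i + (Γ i)ᵀ * g) (ht : ∀ i l j, Γ i l j = Γ j l i) (i : Fin n) :
    chris D hf g G i = Γ i := by
  have hs : ∀ a b, g a b = g b a := fun a b => by conv_lhs => rw [← hg, Matrix.transpose_apply]
  have key : g * chris D hf g G i = g * Γ i := by
    ext a j
    rw [mul_chris D hf g G hgG]
    have e : ∀ i a b, D i (g a b) = (g * Γ i) a b + (g * Γ i) b a := by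
      intro i a b
      have := congrFun (congrFun (hc i) a) b
      rw [Matrix.add_apply] at this
      have e2 : ((Γ i)ᵀ * g) a b = (g * Γ i) b a := by
        rw [← Matrix.transpose_apply (g * _), Matrix.transpose_mul, hg]
      rw [e2] at this
      exact this
    have t : ∀ i a b, (g * Γ i) a b = (g * Γ b) a i := by
      intro i a b
      simp only [Matrix.mul_apply]
      exact Finset.sum_congr rfl fun m _ => by rw [ht]
    rw [e, e, e, t i j a, t j i a, t j a i]
    linear_combination ((g * Γ i) a j) * h2
  have h' : G * g = 1 := mul_eq_one_comm.mp hgG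
  calc _ = G * (g * chris D hf g G i) := by rw [← mul_assoc, h', one_mul]
    _ = _ := by rw [key, ← mul_assoc, h', one_mul]

/-- gauge covariance of curvature -/
lemma riem_gauge (hD : ∀ i j f, D i (D j f) = D j (D i f))
    (Γ : Fin n → Matrix (Fin n) (Fin n) R) (a C : Matrix (Fin n) (Fin n) R) (haC : a * C = 1)
    (i j : Fin n) :
    riem D (fun i => C * (Γ i * a + dM D i a)) i j = C * riem D Γ i j * a := by
  have h' : C * a = 1 := mul_eq_one_comm.mp haC
  have k : ∀ X Y : Matrix (Fin n) (Fin n) R, C * X * (C * Y) = C * X * C * Y := by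
    intros; noncomm_ring
  have k2 : ∀ X : Matrix (Fin n) (Fin n) R, a * (C * X) = X := by
    intros; rw [← mul_assoc, haC, one_mul]
  simp only [riem, dM_mul, dM_add, dM_inv D _ a C haC]
  rw [dM_comm D hD i j a]
  simp only [mul_add, add_mul, mul_sub, sub_mul, mul_assoc, k2, neg_mul]
  abel

/-- covariant derivative of a matrix, antisymmetrised -/
lemma riem_add (Γ T : Fin n → Matrix (Fin n) (Fin n) R) (i j : Fin n) :
    riem D (fun i => Γ i + T i) i j = riem D Γ i j
      + ((dM D i (T j) + Γ i * T j - T j * Γ i) - (dM D j (T i) + Γ j * T i - T i * Γ j))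
      + (T i * T j - T j * T i) := by
  simp only [riem, dM_add]
  noncomm_ring

def dv (i : Fin n) (s : Fin n → R) : Fin n → R := fun k => D i (s k)

lemma dv_mulVec (i : Fin n) (M : Matrix (Fin n) (Fin n) R) (v : Fin n → R) :
    dv D i (M *ᵥ v) = dM D i M *ᵥ v + M *ᵥ dv D i v := by
  ext a
  simp only [dv, dM, Matrix.mulVec, dotProduct, map_sum, Derivation.leibniz, smul_eq_mul,
    Pi.add_apply, ← Finset.sum_add_distrib, Matrix.map_apply]
  exact Finset.sum_congr rfl fun _ _ => by ring

lemma dM_vecMulVec (i : Fin n) (v w : Fin n → R) :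
    dM D i (vecMulVec v w) = vecMulVec (dv D i v) w + vecMulVec v (dv D i w) := by
  ext a b
  simp [dM, dv, vecMulVec_apply]; ring

lemma D_dot (i : Fin n) (v w : Fin n → R) :
    D i (v ⬝ᵥ w) = dv D i v ⬝ᵥ w + v ⬝ᵥ dv D i w := by
  simp only [dv, dotProduct, map_sum, Derivation.leibniz, smul_eq_mul,
    ← Finset.sum_add_distrib]
  exact Finset.sum_congr rfl fun _ _ => by ring

/-- Hessian rows -/
def Hs (Γ : Fin n → Matrix (Fin n) (Fin n) R) (s : Fin n → R) (i : Fin n) : Fin n → R :=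
  dv D i s - (Γ i)ᵀ *ᵥ s

def Tt (g G : Matrix (Fin n) (Fin n) R) (s : Fin n → R) (i : Fin n) : Matrix (Fin n) (Fin n) R :=
  s i • 1 + (vecMulVec (Pi.single i 1) s - vecMulVec (G *ᵥ s) (g i))

def Bb (hf : R) (g G : Matrix (Fin n) (Fin n) R) (Γ : Fin n → Matrix (Fin n) (Fin n) R)
    (s : Fin n → R) : Matrix (Fin n) (Fin n) R :=
  Matrix.of fun j => Hs D Γ s j - s j • s + (hf * (s ⬝ᵥ G *ᵥ s)) • g j

section conf
lemma G_symm
    (g : Matrix (Fin n) (Fin n) R)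
    (G : Matrix (Fin n) (Fin n) R)
    (hgG : g * G = 1)
    (hg : gᵀ = g)
    : Gᵀ = G := by
  have h' : G * g = 1 := mul_eq_one_comm.mp hgG
  have : Gᵀ * g = 1 := by
    have := congrArg Matrix.transpose hgG
    rwa [Matrix.transpose_mul, hg, Matrix.transpose_one] at this
  calc Gᵀ = Gᵀ * (g * G) := by rw [hgG, mul_one]
    _ = G := by rw [← mul_assoc, this, one_mul]

lemma dG
    (g : Matrix (Fin n) (Fin n) R)
    (G : Matrix (Fin n) (Fin n) R)
    (hgG : g * G = 1)
    (Γ : Fin n → Matrix (Fin n) (Fin n) R)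
    (hc : ∀ i, dM D i g = g * Γ i + (Γ i)ᵀ * g)
    (i : Fin n) : dM D i G = - (Γ i * G + G * (Γ i)ᵀ) := by
  have h' : G * g = 1 := mul_eq_one_comm.mp hgG
  rw [dM_inv D i g G hgG, hc, mul_add, add_mul, ← mul_assoc, h', one_mul, mul_assoc, mul_assoc, hgG,
    mul_one]

/-- derivative of a raised covector -/
lemma d_sharp
    (g : Matrix (Fin n) (Fin n) R)
    (G : Matrix (Fin n) (Fin n) R)
    (hgG : g * G = 1)
    (Γ : Fin n → Matrix (Fin n) (Fin n) R)
    (hc : ∀ i, dM D i g = g * Γ i + (Γ i)ᵀ * g)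
    (i : Fin n) (v : Fin n → R) :
    dv D i (G *ᵥ v) + Γ i *ᵥ (G *ᵥ v) = G *ᵥ (dv D i v - (Γ i)ᵀ *ᵥ v) := by
  rw [dv_mulVec, dG D g G hgG Γ hc]
  simp only [Matrix.neg_mulVec, Matrix.add_mulVec, Matrix.mulVec_sub, Matrix.mulVec_mulVec]
  abel

lemma d_grow
    (g : Matrix (Fin n) (Fin n) R)
    (hg : gᵀ = g)
    (Γ : Fin n → Matrix (Fin n) (Fin n) R)
    (hc : ∀ i, dM D i g = g * Γ i + (Γ i)ᵀ * g)
    (i j : Fin n) :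
    dv D i (g j) - (Γ i)ᵀ *ᵥ g j = g *ᵥ (Γ i *ᵥ Pi.single j 1) := by
  ext k
  have := congrFun (congrFun (hc i) k) j
  have hk : ∀ a b, g a b = g b a := fun a b => by conv_lhs => rw [← hg, Matrix.transpose_apply]
  simp only [dM, Matrix.map_apply, Matrix.add_apply] at this
  rw [Matrix.mulVec_mulVec, Matrix.mulVec_single_one]
  simp only [dv, Pi.sub_apply, Matrix.col_apply]
  rw [hk j k, this, Matrix.mul_apply (M := (Γ i)ᵀ)]
  simp only [Matrix.mulVec, dotProduct]
  simp only [fun m => hk j m]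
  ring

lemma nabla_T
    (g : Matrix (Fin n) (Fin n) R)
    (G : Matrix (Fin n) (Fin n) R)
    (hgG : g * G = 1)
    (hg : gᵀ = g)
    (Γ : Fin n → Matrix (Fin n) (Fin n) R)
    (hc : ∀ i, dM D i g = g * Γ i + (Γ i)ᵀ * g)
    (s : Fin n → R)
    (i j : Fin n) :
    dM D i (Tt g G s j) + Γ i * Tt g G s j - Tt g G s j * Γ i =
      D i (s j) • 1 + vecMulVec (Γ i *ᵥ Pi.single j 1) s + vecMulVec (Pi.single j 1) (Hs D Γ s i)
      - vecMulVec (G *ᵥ Hs D Γ s i) (g j) - vecMulVec (G *ᵥ s) (g *ᵥ (Γ i *ᵥ Pi.single j 1)) := by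
  have e1 : dM D i (s j • (1 : Matrix (Fin n) (Fin n) R)) = D i (s j) • 1 := by
    ext a b
    simp only [dM, Matrix.map_apply, Matrix.smul_apply, Matrix.one_apply]
    split_ifs <;> simp
  have e0 : dv D i (Pi.single j (1 : R)) = 0 := by
    ext a
    simp only [dv, Pi.single_apply]
    split_ifs <;> simp
  have e2 : ∀ M N : Matrix (Fin n) (Fin n) R, dM D i (M - N) = dM D i M - dM D i N := by
    intro M N; ext a b; simp [dM]
  rw [← d_grow D g hg Γ hc, Hs, ← d_sharp D g G hgG Γ hc]
  simp only [Tt, dM_add, e1, e2, dM_vecMulVec, e0, mul_add, add_mul, mul_sub, sub_mul,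
    Matrix.mul_vecMulVec, Matrix.vecMulVec_mul, Matrix.mulVec_transpose]
  ext a b
  simp [vecMulVec_apply]
  ring

lemma T_mul
    (g : Matrix (Fin n) (Fin n) R)
    (G : Matrix (Fin n) (Fin n) R)
    (hgG : g * G = 1)
    (hg : gᵀ = g)
    (s : Fin n → R)
    (i j : Fin n) :
    Tt g G s i * Tt g G s j - Tt g G s j * Tt g G s i =
      (s j • vecMulVec (Pi.single i 1) s - (s ⬝ᵥ G *ᵥ s) • vecMulVec (Pi.single i 1) (g j)
        + s i • vecMulVec (G *ᵥ s) (g j)) -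
      (s i • vecMulVec (Pi.single j 1) s - (s ⬝ᵥ G *ᵥ s) • vecMulVec (Pi.single j 1) (g i)
        + s j • vecMulVec (G *ᵥ s) (g i)) := by
  have hk : ∀ a b, g a b = g b a := fun a b => by conv_lhs => rw [← hg, Matrix.transpose_apply]
  have e : ∀ i, g i ⬝ᵥ G *ᵥ s = s i := by
    intro i
    have : (g *ᵥ (G *ᵥ s)) i = s i := by rw [Matrix.mulVec_mulVec, hgG, Matrix.one_mulVec]
    exact this
  simp only [Tt, mul_add, add_mul, mul_sub, sub_mul, Matrix.vecMulVec_mul_vecMulVec,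
    Matrix.mul_smul, Matrix.smul_mul, mul_one, one_mul, e]
  ext a b
  simp [vecMulVec_apply, hk i j]
  ring

lemma Hs_symm
    (Γ : Fin n → Matrix (Fin n) (Fin n) R)
    (ht : ∀ i l j, Γ i l j = Γ j l i)
    (s : Fin n → R)
    (hs : ∀ i j, D i (s j) = D j (s i))
    (j k : Fin n) : Hs D Γ s j k = Hs D Γ s k j := by
  simp only [Hs, Pi.sub_apply, dv, hs j k, Matrix.mulVec, dotProduct, Matrix.transpose_apply]
  congr 1
  exact Finset.sum_congr rfl fun m _ => by rw [ht]

lemma Bb_symm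
    (hf : R)
    (g : Matrix (Fin n) (Fin n) R)
    (G : Matrix (Fin n) (Fin n) R)
    (hg : gᵀ = g)
    (Γ : Fin n → Matrix (Fin n) (Fin n) R)
    (ht : ∀ i l j, Γ i l j = Γ j l i)
    (s : Fin n → R)
    (hs : ∀ i j, D i (s j) = D j (s i))
    (j k : Fin n) : Bb D hf g G Γ s j k = Bb D hf g G Γ s k j := by
  have hk : ∀ a b, g a b = g b a := fun a b => by conv_lhs => rw [← hg, Matrix.transpose_apply]
  simp only [Bb, Matrix.of_apply, Pi.add_apply, Pi.sub_apply, Pi.smul_apply, smul_eq_mul,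
    Hs_symm D Γ ht s hs j k, hk j k]
  ring

lemma G_mul_Bb
    (hf : R)
    (g : Matrix (Fin n) (Fin n) R)
    (G : Matrix (Fin n) (Fin n) R)
    (hgG : g * G = 1)
    (hg : gᵀ = g)
    (Γ : Fin n → Matrix (Fin n) (Fin n) R)
    (ht : ∀ i l j, Γ i l j = Γ j l i)
    (s : Fin n → R)
    (hs : ∀ i j, D i (s j) = D j (s i))
    (l j : Fin n) : (G * Bb D hf g G Γ s) l j =
    (G *ᵥ Hs D Γ s j) l - s j * (G *ᵥ s) l
      + hf * (s ⬝ᵥ G *ᵥ s) * (1 : Matrix (Fin n) (Fin n) R) l j := by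
  have hk : ∀ a b, g a b = g b a := fun a b => by conv_lhs => rw [← hg, Matrix.transpose_apply]
  have e : (G * Bb D hf g G Γ s) l j = (G *ᵥ (Bb D hf g G Γ s j)) l := by
    simp only [Matrix.mul_apply, Matrix.mulVec, dotProduct]
    exact Finset.sum_congr rfl fun m _ => by rw [Bb_symm D hf g G hg Γ ht s hs m j]
  have e1 : (G *ᵥ g j) l = (1 : Matrix (Fin n) (Fin n) R) l j := by
    rw [← mul_eq_one_comm.mp hgG, Matrix.mul_apply]
    simp only [Matrix.mulVec, dotProduct]
    exact Finset.sum_congr rfl fun m _ => by rw [hk m j]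
  have : Bb D hf g G Γ s j = Hs D Γ s j - s j • s + (hf * (s ⬝ᵥ G *ᵥ s)) • g j := rfl
  rw [e, this, Matrix.mulVec_add, Matrix.mulVec_sub, Matrix.mulVec_smul, Matrix.mulVec_smul]
  simp only [Pi.add_apply, Pi.sub_apply, Pi.smul_apply, smul_eq_mul, e1]

lemma riem_conf
    (hf : R)
    (h2 : hf + hf = 1)
    (g : Matrix (Fin n) (Fin n) R)
    (G : Matrix (Fin n) (Fin n) R)
    (hgG : g * G = 1)
    (hg : gᵀ = g)
    (Γ : Fin n → Matrix (Fin n) (Fin n) R)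
    (hc : ∀ i, dM D i g = g * Γ i + (Γ i)ᵀ * g)
    (ht : ∀ i l j, Γ i l j = Γ j l i)
    (s : Fin n → R)
    (hs : ∀ i j, D i (s j) = D j (s i))
    (i j : Fin n) :
    riem D (fun i => Γ i + Tt g G s i) i j = riem D Γ i j - KN g G (Bb D hf g G Γ s) i j := by
  have hk : ∀ a b, g a b = g b a := fun a b => by conv_lhs => rw [← hg, Matrix.transpose_apply]
  rw [riem_add, nabla_T D g G hgG hg Γ hc, nabla_T D g G hgG hg Γ hc, T_mul g G hgG hg]
  have e1 : Γ i *ᵥ Pi.single j 1 = Γ j *ᵥ Pi.single i 1 := by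
    ext k; simp [ht i k j]
  ext l k
  simp only [KN, Matrix.add_apply, Matrix.sub_apply, Matrix.of_apply, Matrix.smul_apply,
    vecMulVec_apply, smul_eq_mul, G_mul_Bb D hf g G hgG hg Γ ht s hs, e1, hs j i]
  simp only [Bb, Matrix.of_apply, Pi.add_apply, Pi.sub_apply, Pi.smul_apply, smul_eq_mul,
    Matrix.one_apply, Pi.single_apply]
  linear_combination ((s ⬝ᵥ G *ᵥ s) * ((if l = i then 1 else 0) * g j k)
    - (s ⬝ᵥ G *ᵥ s) * ((if l = j then 1 else 0) * g i k)) * h2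

lemma D_norm
    (hf : R)
    (g : Matrix (Fin n) (Fin n) R)
    (G : Matrix (Fin n) (Fin n) R)
    (hgG : g * G = 1)
    (Γ : Fin n → Matrix (Fin n) (Fin n) R)
    (hc : ∀ i, dM D i g = g * Γ i + (Γ i)ᵀ * g)
    (s : Fin n → R)
    (h2 : hf + hf = 1) (hg : gᵀ = g) (i : Fin n) :
    D i (hf * (s ⬝ᵥ G *ᵥ s)) = (G *ᵥ s) ⬝ᵥ Hs D Γ s i := by
  have hhf : D i hf = 0 := by
    have e : (2 : ℝ) • hf = 1 := by rw [two_smul]; exact h2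
    have e' : hf = algebraMap ℝ R (1/2) := by
      rw [Algebra.algebraMap_eq_smul_one, ← e, smul_smul]; norm_num
    rw [e', Derivation.map_algebraMap]
  have hG := G_symm g G hgG hg
  have a1 : ∀ v w : Fin n → R, v ⬝ᵥ G *ᵥ w = (G *ᵥ v) ⬝ᵥ w := by
    intro v w
    rw [Matrix.dotProduct_mulVec, ← Matrix.mulVec_transpose, hG]
  have e := d_sharp D g G hgG Γ hc i s
  have e3 : dv D i (G *ᵥ s) = G *ᵥ Hs D Γ s i - Γ i *ᵥ (G *ᵥ s) := eq_sub_of_add_eq e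
  rw [Derivation.leibniz, hhf, D_dot, e3, dotProduct_sub, a1 s (Hs D Γ s i)]
  have e4 : dv D i s = Hs D Γ s i + (Γ i)ᵀ *ᵥ s := by simp [Hs]
  have e5 : ((Γ i)ᵀ *ᵥ s) ⬝ᵥ (G *ᵥ s) = s ⬝ᵥ (Γ i *ᵥ (G *ᵥ s)) := by
    rw [Matrix.mulVec_transpose, ← Matrix.dotProduct_mulVec]
  rw [e4, add_dotProduct, e5, dotProduct_comm (Hs D Γ s i)]
  simp only [smul_eq_mul, mul_zero, add_zero]
  linear_combination ((G *ᵥ s) ⬝ᵥ Hs D Γ s i) * h2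

lemma ricci_id
    (Γ : Fin n → Matrix (Fin n) (Fin n) R)
    (s : Fin n → R)
    (hD : ∀ i j f, D i (D j f) = D j (D i f)) (i j : Fin n) :
    (dv D i (Hs D Γ s j) - (Γ i)ᵀ *ᵥ Hs D Γ s j) - (dv D j (Hs D Γ s i) - (Γ j)ᵀ *ᵥ Hs D Γ s i)
      = - ((riem D Γ i j)ᵀ *ᵥ s) := by
  have e2 : ∀ i, ∀ M N : Fin n → R, dv D i (M - N) = dv D i M - dv D i N := by
    intro i M N; ext a; simp [dv]
  have e3 : dv D i (dv D j s) = dv D j (dv D i s) := by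
    ext a; simp [dv, hD i j]
  simp only [Hs, riem, e2, dv_mulVec, e3, Matrix.transpose_add, Matrix.transpose_sub,
    Matrix.transpose_mul, dM_transpose, Matrix.add_mulVec, Matrix.sub_mulVec, Matrix.mulVec_sub,
    Matrix.mulVec_mulVec]
  abel

lemma codazzi
    (hf : R)
    (h2 : hf + hf = 1)
    (g : Matrix (Fin n) (Fin n) R)
    (G : Matrix (Fin n) (Fin n) R)
    (hgG : g * G = 1)
    (hg : gᵀ = g)
    (Γ : Fin n → Matrix (Fin n) (Fin n) R)
    (hc : ∀ i, dM D i g = g * Γ i + (Γ i)ᵀ * g)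
    (ht : ∀ i l j, Γ i l j = Γ j l i)
    (s : Fin n → R)
    (hs : ∀ i j, D i (s j) = D j (s i))
    (hD : ∀ i j f, D i (D j f) = D j (D i f))
    (hR : ∀ i j, riem D Γ i j = KN g G (Bb D hf g G Γ s) i j) (i j : Fin n) :
    dv D i (Bb D hf g G Γ s j) - (Γ i)ᵀ *ᵥ Bb D hf g G Γ s j =
    dv D j (Bb D hf g G Γ s i) - (Γ j)ᵀ *ᵥ Bb D hf g G Γ s i := by
  have hk : ∀ a b, g a b = g b a := fun a b => by conv_lhs => rw [← hg, Matrix.transpose_apply]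
  have hN := D_norm D hf g G hgG Γ hc s h2 hg
  have e1 : Γ i *ᵥ Pi.single j 1 = Γ j *ᵥ Pi.single i 1 := by
    ext k; simp [ht i k j]
  -- general expansion
  have ex : ∀ i j, dv D i (Bb D hf g G Γ s j) - (Γ i)ᵀ *ᵥ Bb D hf g G Γ s j =
      (dv D i (Hs D Γ s j) - (Γ i)ᵀ *ᵥ Hs D Γ s j) - D i (s j) • s - s j • Hs D Γ s i
      + ((G *ᵥ s) ⬝ᵥ Hs D Γ s i) • g j
      + (hf * (s ⬝ᵥ G *ᵥ s)) • (g *ᵥ (Γ i *ᵥ Pi.single j 1)) := by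
    intro i j
    rw [← hN, ← d_grow D g hg Γ hc]
    have : Bb D hf g G Γ s j = Hs D Γ s j - s j • s + (hf * (s ⬝ᵥ G *ᵥ s)) • g j := rfl
    rw [this]
    simp only [Matrix.mulVec_add, Matrix.mulVec_sub, Matrix.mulVec_smul]
    generalize hf * (s ⬝ᵥ G *ᵥ s) = c
    have hH : Hs D Γ s i = dv D i s - (Γ i)ᵀ *ᵥ s := rfl
    rw [hH]
    generalize Hs D Γ s j = H
    ext k
    simp only [dv, Pi.add_apply, Pi.sub_apply, Pi.smul_apply, smul_eq_mul, map_add, map_sub,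
      Derivation.leibniz]
    ring
  have hRs : (riem D Γ i j)ᵀ *ᵥ s = s i • Bb D hf g G Γ s j
      - ((G *ᵥ s) ⬝ᵥ Bb D hf g G Γ s j) • g i
      - (s j • Bb D hf g G Γ s i - ((G *ᵥ s) ⬝ᵥ Bb D hf g G Γ s i) • g j) := by
    have q : ∀ j, ∑ l, (G * Bb D hf g G Γ s) l j * s l = (G *ᵥ s) ⬝ᵥ Bb D hf g G Γ s j := by
      intro j
      have hG := G_symm g G hgG hg
      have : ∑ l, (G * Bb D hf g G Γ s) l j * s l = (s ᵥ* (G * Bb D hf g G Γ s)) j := by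
        simp [Matrix.vecMul, dotProduct, mul_comm]
      rw [this, ← Matrix.vecMul_vecMul, ← Matrix.mulVec_transpose G, hG]
      simp only [Matrix.vecMul, dotProduct]
      exact Finset.sum_congr rfl fun m _ => by rw [Bb_symm D hf g G hg Γ ht s hs m j]
    rw [hR]
    ext k
    have : ((KN g G (Bb D hf g G Γ s) i j)ᵀ *ᵥ s) k =
       (∑ l, (1 : Matrix (Fin n) (Fin n) R) l i * s l) * Bb D hf g G Γ s j k
        - (∑ l, (G * Bb D hf g G Γ s) l j * s l) * g i k
       - ((∑ l, (1 : Matrix (Fin n) (Fin n) R) l j * s l) * Bb D hf g G Γ s i k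
        - (∑ l, (G * Bb D hf g G Γ s) l i * s l) * g j k) := by
      simp only [Finset.sum_mul, ← Finset.sum_sub_distrib, Matrix.mulVec, dotProduct,
        Matrix.transpose_apply, KN, Matrix.of_apply]
      exact Finset.sum_congr rfl fun m _ => by ring
    rw [this, q, q]
    simp [Matrix.one_apply]
  have hRI := ricci_id D Γ s hD i j
  rw [hRs] at hRI
  have e : ∀ i, g i ⬝ᵥ G *ᵥ s = s i := by
    intro i
    have : (g *ᵥ (G *ᵥ s)) i = s i := by rw [Matrix.mulVec_mulVec, hgG, Matrix.one_mulVec]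
    exact this
  have hBs : ∀ j, (G *ᵥ s) ⬝ᵥ Bb D hf g G Γ s j = (G *ᵥ s) ⬝ᵥ Hs D Γ s j - s j * (s ⬝ᵥ G *ᵥ s)
       + hf * (s ⬝ᵥ G *ᵥ s) * s j := by
    intro j
    have : Bb D hf g G Γ s j = Hs D Γ s j - s j • s + (hf * (s ⬝ᵥ G *ᵥ s)) • g j := rfl
    rw [this, dotProduct_add, dotProduct_sub, dotProduct_smul, dotProduct_smul,
      dotProduct_comm _ (g j), e, dotProduct_comm _ s]
    simp
  rw [hBs, hBs] at hRI
  rw [ex, ex, e1, hs j i]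
  ext k
  have := congrFun hRI k
  simp only [Bb, Matrix.of_apply, Pi.add_apply, Pi.sub_apply, Pi.smul_apply, smul_eq_mul,
    Pi.neg_apply] at this ⊢
  have h3 := congrFun e1 k
  linear_combination this + ((s ⬝ᵥ G *ᵥ s) * (s j * g i k - s i * g j k)) * h2

/-- Christoffel symbols of the conformal metric. -/
lemma conf_chris
    (hf : R)
    (g : Matrix (Fin n) (Fin n) R)
    (G : Matrix (Fin n) (Fin n) R)
    (Γ : Fin n → Matrix (Fin n) (Fin n) R)
    (s : Fin n → R)
    (u ui : R) (hu : u * ui = 1) (hdu : ∀ i, D i u = (2 * s i) * u) (i : Fin n)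
    (h2 : hf + hf = 1) (hgG : g * G = 1) (hg : gᵀ = g)
    (hc : ∀ i, dM D i g = g * Γ i + (Γ i)ᵀ * g) (ht : ∀ i l j, Γ i l j = Γ j l i) :
    chris D hf (u • g) (ui • G) i = Γ i + Tt g G s i := by
  have hk : ∀ a b, g a b = g b a := fun a b => by conv_lhs => rw [← hg, Matrix.transpose_apply]
  refine chris_unique D hf h2 (u • g) (ui • G) ?_ ?_ (fun i => Γ i + Tt g G s i) ?_ ?_ i
  · rw [Matrix.smul_mul, Matrix.mul_smul, smul_smul, hu, hgG, one_smul]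
  · rw [Matrix.transpose_smul, hg]
  · intro i
    have e1 : dM D i (u • g) = D i u • g + u • dM D i g := by
      ext a b; simp [dM]; ring
    have e2 : g * Tt g G s i = s i • g + (vecMulVec (g i) s - vecMulVec s (g i)) := by
      simp only [Tt, mul_add, mul_sub, Matrix.mul_vecMulVec, Matrix.mulVec_mulVec, hgG,
        Matrix.one_mulVec, Matrix.mul_smul, mul_one]
      congr 3
      ext k; simp [hk i k]
    have e3 : (Tt g G s i)ᵀ * g = (g * Tt g G s i)ᵀ := by
      rw [Matrix.transpose_mul, hg]
    rw [e1, hc, hdu, Matrix.transpose_add, mul_add, add_mul, Matrix.smul_mul, Matrix.smul_mul,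
      Matrix.mul_smul, Matrix.mul_smul, e3, e2]
    ext a b
    simp [vecMulVec_apply, hk b a]
    ring
  · intro i l j
    simp only [Tt, Matrix.add_apply, Matrix.sub_apply, vecMulVec_apply, Matrix.smul_apply,
      Matrix.one_apply, Pi.single_apply, smul_eq_mul, ht i l j, hk i j]
    ring

/-- Christoffel symbols of the dual metric. -/
lemma dual_chris
    (hf : R)
    (g : Matrix (Fin n) (Fin n) R)
    (G : Matrix (Fin n) (Fin n) R)
    (Γ : Fin n → Matrix (Fin n) (Fin n) R)
    (B Bi : Matrix (Fin n) (Fin n) R) (hB : Bᵀ = B) (hBB : B * Bi = 1)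
    (h2 : hf + hf = 1) (hgG : g * G = 1) (hg : gᵀ = g)
    (hc : ∀ i, dM D i g = g * Γ i + (Γ i)ᵀ * g) 
    (hcod : ∀ i j, dv D i (B j) - (Γ i)ᵀ *ᵥ B j = dv D j (B i) - (Γ j)ᵀ *ᵥ B i) (i : Fin n) :
    chris D hf (B * G * B) (Bi * g * Bi) i = (Bi * g) * (Γ i * (G * B) + dM D i (G * B)) := by
  have hG := G_symm g G hgG hg
  have hGg : G * g = 1 := mul_eq_one_comm.mp hgG
  have hBB' : Bi * B = 1 := mul_eq_one_comm.mp hBB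
  have k1 : ∀ X, g * (G * X) = X := fun X => by rw [← mul_assoc, hgG, one_mul]
  have k2 : ∀ X, G * (g * X) = X := fun X => by rw [← mul_assoc, hGg, one_mul]
  have k3 : ∀ X, B * (Bi * X) = X := fun X => by rw [← mul_assoc, hBB, one_mul]
  have k4 : ∀ X, Bi * (B * X) = X := fun X => by rw [← mul_assoc, hBB', one_mul]
  refine chris_unique D hf h2 _ _ ?_ ?_ (fun i => (Bi * g) * (Γ i * (G * B) + dM D i (G * B))) ?_ ?_ i
  · simp only [mul_assoc, k3, k2, hBB]
  · simp only [Matrix.transpose_mul, hB, hG, mul_assoc]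
  · intro i
    have hBi : Biᵀ = Bi := G_symm B Bi hBB hB
    have dB : (dM D i B)ᵀ = dM D i B := by rw [← dM_transpose, hB]
    have dGt : (dM D i G)ᵀ = dM D i G := by rw [← dM_transpose, hG]
    simp only [Matrix.transpose_mul, Matrix.transpose_add, hB, hG, hg, hBi, dM_mul, dB,
      dG D g G hgG Γ hc]
    simp only [mul_add, add_mul, mul_assoc, k1, k2, k3, k4, neg_mul, mul_neg, Matrix.transpose_neg,
      Matrix.transpose_mul, Matrix.transpose_add, hG, Matrix.transpose_transpose]
    abel
  · intro i l j
    have e : ∀ i j, (Γ i * (G * B) + dM D i (G * B)) *ᵥ Pi.single j 1 =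
        G *ᵥ (dv D i (B j) - (Γ i)ᵀ *ᵥ B j) := by
      intro i j
      have e0 : B *ᵥ Pi.single j 1 = B j := by
        ext k
        rw [Matrix.mulVec_single_one, Matrix.col_apply]
        conv_lhs => rw [← hB, Matrix.transpose_apply]
      have e1 : dv D i ((G * B) *ᵥ Pi.single j 1) = dM D i (G * B) *ᵥ Pi.single j 1 := by
        ext k; simp [dv, dM]
      rw [← d_sharp D g G hgG Γ hc, Matrix.add_mulVec, ← e1, ← Matrix.mulVec_mulVec,
        ← Matrix.mulVec_mulVec, e0, add_comm]
    have e' : ∀ M : Matrix (Fin n) (Fin n) R, ∀ l j, M l j = (M *ᵥ Pi.single j 1) l := by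
      intro M l j; simp
    change (Bi * g * (Γ i * (G * B) + dM D i (G * B))) l j =
      (Bi * g * (Γ j * (G * B) + dM D j (G * B))) l i
    rw [e' (Bi * g * (Γ i * (G * B) + dM D i (G * B))) l j,
      e' (Bi * g * (Γ j * (G * B) + dM D j (G * B))) l i, ← Matrix.mulVec_mulVec, e, hcod, ← e, Matrix.mulVec_mulVec]

/-- Curvature of the dual metric. -/
lemma dual_riem
    (hf : R)
    (g : Matrix (Fin n) (Fin n) R)
    (G : Matrix (Fin n) (Fin n) R)
    (Γ : Fin n → Matrix (Fin n) (Fin n) R)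
    (hD : ∀ i j f, D i (D j f) = D j (D i f))
    (B Bi : Matrix (Fin n) (Fin n) R) (hB : Bᵀ = B) (hBB : B * Bi = 1)
    (h2 : hf + hf = 1) (hgG : g * G = 1) (hg : gᵀ = g)
    (hc : ∀ i, dM D i g = g * Γ i + (Γ i)ᵀ * g)
    (hcod : ∀ i j, dv D i (B j) - (Γ i)ᵀ *ᵥ B j = dv D j (B i) - (Γ j)ᵀ *ᵥ B i)
    (hR : ∀ i j, riem D Γ i j = KN g G B i j) (i j : Fin n) :
    riem D (chris D hf (B * G * B) (Bi * g * Bi)) i j = KN (B * G * B) (Bi * g * Bi) B i j := by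
  have hG := G_symm g G hgG hg
  have hGg : G * g = 1 := mul_eq_one_comm.mp hgG
  have hBB' : Bi * B = 1 := mul_eq_one_comm.mp hBB
  have e : chris D hf (B * G * B) (Bi * g * Bi) =
      fun i => (Bi * g) * (Γ i * (G * B) + dM D i (G * B)) :=
    funext fun i => dual_chris D hf g G Γ B Bi hB hBB h2 hgG hg hc hcod i
  have hinv : (Bi * g) * (G * B) = 1 := by
    rw [mul_assoc, ← mul_assoc g, hgG, one_mul, hBB']
  rw [e, riem_gauge D hD Γ (G * B) (Bi * g) (mul_eq_one_comm.mp hinv), hR]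
  have kn : ∀ (g G B : Matrix (Fin n) (Fin n) R), KN g G B i j =
      vecMulVec (Pi.single i 1) (B j) - vecMulVec ((G * B) *ᵥ Pi.single j 1) (g i)
      - (vecMulVec (Pi.single j 1) (B i) - vecMulVec ((G * B) *ᵥ Pi.single i 1) (g j)) := by
    intro g G B
    ext l k
    simp [KN, vecMulVec_apply, Matrix.one_apply, Pi.single_apply]
  have r : ∀ (M N : Matrix (Fin n) (Fin n) R) i, M i ᵥ* N = (M * N) i := by
    intro M N i; rfl
  have q : (Bi * g * Bi) * B = Bi * g := by rw [mul_assoc, hBB', mul_one]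
  rw [kn, kn, q]
  simp only [mul_sub, sub_mul, Matrix.mul_vecMulVec, Matrix.vecMulVec_mul, r, Matrix.mulVec_mulVec,
    hinv, Matrix.one_mulVec]
  rw [← mul_assoc B G B, ← mul_assoc g, hgG, one_mul]
  abel
end conf
end Abs
end GCFAux

namespace GCFAux
open Matrix Loc TopologicalSpace

section Conc
variable {n : ℕ}

/-- extension by zero -/
def ext (V : Opens (Pt n)) (f : V → ℝ) : Pt n → ℝ := by
  classical exact fun q => if h : q ∈ V then f ⟨q, h⟩ else 0

lemma ext_apply (V : Opens (Pt n)) (f : V → ℝ) (q : V) : ext V f q = f q := by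
  simp [ext]

/-- smooth functions on `V` -/
def FV (V : Opens (Pt n)) : Subalgebra ℝ (V → ℝ) where
  carrier := {f | ContDiffOn ℝ (⊤ : ℕ∞) (ext V f) V}
  mul_mem' {a b} ha hb :=
    (ContDiffOn.mul ha hb).congr fun q hq => by
      simp [ext, show q ∈ V from hq]
  add_mem' {a b} ha hb :=
    (ContDiffOn.add ha hb).congr fun q hq => by
      simp [ext, show q ∈ V from hq]
  algebraMap_mem' r :=
    (contDiffOn_const (c := r)).congr fun q hq => by
      simp [ext, show q ∈ V from hq]

def mkF (V : Opens (Pt n)) (F : Pt n → ℝ) (hF : ContDiffOn ℝ (⊤ : ℕ∞) F V) : FV V :=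
  ⟨fun q => F q, hF.congr fun q hq => by simp [ext, show q ∈ V from hq]⟩

lemma ext_ev (V : Opens (Pt n)) (f : Pt n → ℝ) (F : V → ℝ) (h : ∀ q : V, f q = F q) (q : V) :
    f =ᶠ[nhds (q : Pt n)] ext V F := by
  filter_upwards [V.isOpen.mem_nhds q.2] with x hx
  rw [ext_apply V F ⟨x, hx⟩, ← h]

lemma pd_congr (i : Fin n) {f g : Pt n → ℝ} {p : Pt n} (h : f =ᶠ[nhds p] g) :
    pd i f p = pd i g p := by
  simp only [pd, h.fderiv_eq]

lemma diffAt (V : Opens (Pt n)) (f : FV V) (q : V) : DifferentiableAt ℝ (ext V f.1) q :=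
  (f.2.contDiffAt (V.isOpen.mem_nhds q.2)).differentiableAt (by simp)

lemma pd_smooth (V : Opens (Pt n)) (i : Fin n) (F : Pt n → ℝ) (hF : ContDiffOn ℝ (⊤ : ℕ∞) F V) :
    ContDiffOn ℝ (⊤ : ℕ∞) (pd i F) V := by
  have : ContDiffOn ℝ (⊤ : ℕ∞) (fderiv ℝ F) V :=
    hF.fderiv_of_isOpen V.isOpen (by simp)
  exact this.clm_apply contDiffOn_const

/-- coordinate derivations -/
def DV (V : Opens (Pt n)) (i : Fin n) : Derivation ℝ (FV V) (FV V) :=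
  Derivation.mk'
    { toFun := fun f => mkF V (pd i (ext V f.1)) (pd_smooth V i _ f.2)
      map_add' := fun f g => by
        apply Subtype.ext; funext q
        have e : pd i (ext V (f + g).1) q = pd i (ext V f.1 + ext V g.1) q :=
          (pd_congr i (ext_ev V _ _ (fun q => by simp [ext_apply]) q)).symm
        change pd i (ext V (f + g).1) q = pd i (ext V f.1) q + pd i (ext V g.1) q
        rw [e, pd, fderiv_add (diffAt V f q) (diffAt V g q)]; rfl
      map_smul' := fun c f => by
        apply Subtype.ext; funext q
        have e : pd i (ext V (c • f).1) q = pd i (c • ext V f.1) q :=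
          (pd_congr i (ext_ev V _ _ (fun q => by simp [ext_apply]) q)).symm
        change pd i (ext V (c • f).1) q = c * pd i (ext V f.1) q
        rw [e, pd, fderiv_const_smul (diffAt V f q)]; rfl }
    (fun f g => by
        apply Subtype.ext; funext q
        have e : pd i (ext V (f * g).1) q = pd i (ext V f.1 * ext V g.1) q :=
          (pd_congr i (ext_ev V _ _ (fun q => by simp [ext_apply]) q)).symm
        change pd i (ext V (f * g).1) q = f.1 q * pd i (ext V g.1) q + g.1 q * pd i (ext V f.1) q
        rw [e, pd, fderiv_mul (diffAt V f q) (diffAt V g q), ext_apply, ext_apply]; rfl)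

lemma pd_eq (V : Opens (Pt n)) (i : Fin n) (f : Pt n → ℝ) (F : FV V) (h : ∀ q : V, f q = F.1 q)
    (q : V) : pd i f q = (DV V i F).1 q :=
  pd_congr i (ext_ev V f F.1 h q)

lemma DV_comm (V : Opens (Pt n)) (i j : Fin n) (f : FV V) :
    DV V i (DV V j f) = DV V j (DV V i f) := by
  apply Subtype.ext; funext q
  rw [← pd_eq V i (pd j (ext V f.1)) (DV V j f) (fun _ => rfl),
    ← pd_eq V j (pd i (ext V f.1)) (DV V i f) (fun _ => rfl)]
  have hc : ContDiffAt ℝ (⊤ : ℕ∞) (ext V f.1) q := f.2.contDiffAt (V.isOpen.mem_nhds q.2)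
  have hs : IsSymmSndFDerivAt ℝ (ext V f.1) q := hc.isSymmSndFDerivAt (by
    rw [minSmoothness_of_isRCLikeNormedField]; exact WithTop.coe_le_coe.mpr (le_top : (2 : ℕ∞) ≤ ⊤))
  have hd : DifferentiableAt ℝ (fderiv ℝ (ext V f.1)) q :=
    (hc.fderiv_right (m := 1) (by
      rw [one_add_one_eq_two]; exact WithTop.coe_le_coe.mpr (le_top : (2 : ℕ∞) ≤ ⊤))).differentiableAt (by simp)
  have k : ∀ i j : Fin n, pd i (pd j (ext V f.1)) q =
      fderiv ℝ (fderiv ℝ (ext V f.1)) q (Pi.single i 1) (Pi.single j 1) := by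
    intro i j
    have : pd j (ext V f.1) = fun x => (fderiv ℝ (ext V f.1) x) (Pi.single j 1) := rfl
    rw [pd, this, fderiv_clm_apply hd (by fun_prop)]
    simp
  rw [k, k, hs.eq]

def ev (V : Opens (Pt n)) (q : V) : FV V →+* ℝ :=
  ((Pi.evalRingHom (fun _ : V => ℝ) q).comp (FV V).val.toRingHom)

lemma ev_apply (V : Opens (Pt n)) (q : V) (f : FV V) : ev V q f = f.1 q := rfl

lemma FV_ext (V : Opens (Pt n)) {f g : FV V} (h : ∀ q, ev V q f = ev V q g) : f = g :=
  Subtype.ext (funext h)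

lemma isUnit_FV (V : Opens (Pt n)) (f : FV V) (h : ∀ q, ev V q f ≠ 0) : IsUnit f := by
  have hs : ContDiffOn ℝ (⊤ : ℕ∞) (fun x => (ext V f.1 x)⁻¹) V :=
    ContDiffOn.inv f.2 fun x hx => by
      have := h ⟨x, hx⟩
      rwa [ev_apply, ← ext_apply V f.1 ⟨x, hx⟩] at this
  refine IsUnit.of_mul_eq_one (mkF V _ hs) (FV_ext V fun q => ?_)
  rw [map_mul, map_one, ev_apply, ev_apply]
  change f.1 q * (ext V f.1 q)⁻¹ = 1
  rw [ext_apply]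
  exact mul_inv_cancel₀ (h q)

def halfF (V : Opens (Pt n)) : FV V := algebraMap ℝ (FV V) (1 / 2)

lemma ev_half (V : Opens (Pt n)) (q : V) : ev V q (halfF V) = 1 / 2 := rfl

lemma half_add (V : Opens (Pt n)) : halfF V + halfF V = 1 := by
  rw [halfF, ← map_add]; norm_num

/-- evaluation of matrices -/
lemma ev_inv (V : Opens (Pt n)) (q : V) (M N : Matrix (Fin n) (Fin n) (FV V)) (h : M * N = 1) :
    (M.map (ev V q))⁻¹ = N.map (ev V q) := by
  apply Matrix.inv_eq_right_inv
  rw [← Matrix.map_mul, h]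
  simp

lemma christoffel_eq (V : Opens (Pt n)) (g : Pt n → Mat n) (gR GR : Matrix (Fin n) (Fin n) (FV V))
    (hg : ∀ q : V, g q = gR.map (ev V q)) (hgG : gR * GR = 1) (q : V) (k i j : Fin n) :
    christoffel g k i j q = ev V q (chris (DV V) (halfF V) gR GR i k j) := by
  have e : ∀ i a b, pd i (fun x => g x a b) q = ev V q (DV V i (gR a b)) := by
    intro i a b
    exact pd_eq V i _ _ (fun x => by rw [hg]; rfl) q
  simp only [christoffel, chris, Matrix.of_apply, map_mul, map_sum, map_add, map_sub, ev_half, e]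
  rw [hg, ev_inv V q gR GR hgG]
  rfl

lemma riemann_eq (V : Opens (Pt n)) (g : Pt n → Mat n) (gR GR : Matrix (Fin n) (Fin n) (FV V))
    (hg : ∀ q : V, g q = gR.map (ev V q)) (hgG : gR * GR = 1) (q : V) (l i j k : Fin n) :
    riemann g l i j k q = ev V q (riem (DV V) (chris (DV V) (halfF V) gR GR) i j l k) := by
  have c := christoffel_eq V g gR GR hg hgG
  have e : ∀ i l j k, pd i (christoffel g l j k) q =
      ev V q (DV V i (chris (DV V) (halfF V) gR GR j l k)) := by
    intro i l j k
    exact pd_eq V i _ _ (fun x => c x l j k) q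
  simp only [riemann, riem, e, c, Matrix.add_apply, Matrix.sub_apply, Matrix.mul_apply, dM,
    Matrix.map_apply, map_add, map_sub, map_sum, map_mul, Finset.sum_sub_distrib]

lemma KN_map (V : Opens (Pt n)) (q : V) (g G B : Matrix (Fin n) (Fin n) (FV V)) (i j l k : Fin n) :
    ev V q (KN g G B i j l k) =
      KN (g.map (ev V q)) (G.map (ev V q)) (B.map (ev V q)) i j l k := by
  have o : ∀ a b, ev V q ((1 : Matrix (Fin n) (Fin n) (FV V)) a b)
      = (1 : Matrix (Fin n) (Fin n) ℝ) a b := by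
    intro a b
    simp only [Matrix.one_apply]; split_ifs <;> simp
  simp only [KN, Matrix.of_apply, map_sub, map_mul, o, ← Matrix.map_mul, Matrix.map_apply]

lemma schouten_of_KN (hn : 3 ≤ n) (g : Pt n → Mat n) (p : Pt n) (B : Mat n)
    (hg : (g p)ᵀ = g p) (hB : Bᵀ = B) (hdet : IsUnit (g p).det)
    (h : ∀ l i j k, riemann g l i j k p = KN (g p) (g p)⁻¹ B i j l k) : schouten g p = B := by
  have hgG : g p * (g p)⁻¹ = 1 := Matrix.mul_nonsing_inv _ hdet
  have hGg : (g p)⁻¹ * g p = 1 := Matrix.nonsing_inv_mul _ hdet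
  have hG : ((g p)⁻¹)ᵀ = (g p)⁻¹ := by rw [Matrix.transpose_nonsing_inv, hg]
  set t : ℝ := ((g p)⁻¹ * B).trace with ht
  have hR : ∀ j k, ricci g j k p = ((n : ℝ) - 2) * B j k + t * g p j k := by
    intro j k
    have e1 : ∑ i, ((g p)⁻¹ * B) i j * g p i k = B j k := by
      have : ∑ i, ((g p)⁻¹ * B) i j * g p i k = ((((g p)⁻¹ * B)ᵀ) * g p) j k := by
        rw [Matrix.mul_apply]; rfl
      rw [this, Matrix.transpose_mul, hG, hB, mul_assoc, hGg, mul_one]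
    simp only [ricci, h, KN, Matrix.of_apply, Finset.sum_sub_distrib, e1]
    rw [← Finset.sum_mul, ← Finset.sum_mul]
    have e2 : ∑ i, ((g p)⁻¹ * B) i i = t := rfl
    rw [e2]
    simp [Matrix.one_apply]
    ring
  have hS : scalarCurv g p = (2 * (n - 1 : ℝ)) * t := by
    have e1 : ∀ M : Mat n, Mᵀ = M → ∑ j, ∑ k, (g p)⁻¹ j k * M j k = ((g p)⁻¹ * M).trace := by
      intro M hM
      simp only [Matrix.trace, Matrix.diag_apply, Matrix.mul_apply]
      refine Finset.sum_congr rfl fun j _ => Finset.sum_congr rfl fun k _ => ?_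
      conv_lhs => rw [← hM, Matrix.transpose_apply]
    have e2 : scalarCurv g p = ((n : ℝ) - 2) * (∑ j, ∑ k, (g p)⁻¹ j k * B j k)
        + t * (∑ j, ∑ k, (g p)⁻¹ j k * g p j k) := by
      simp only [scalarCurv, hR, Finset.mul_sum, ← Finset.sum_add_distrib]
      refine Finset.sum_congr rfl fun j _ => Finset.sum_congr rfl fun k _ => ?_
      ring
    rw [e2, e1 B hB, e1 _ hg, hGg, ← ht]
    simp
    ring
  have hn' : (3 : ℝ) ≤ n := by exact_mod_cast hn
  have n1 : (n : ℝ) - 1 ≠ 0 := by linarith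
  have n2 : (n : ℝ) - 2 ≠ 0 := by linarith
  ext j k
  simp only [schouten, Matrix.smul_apply, Matrix.of_apply, hR, hS, smul_eq_mul]
  field_simp
  ring

/-- everything about a conformally flat metric on a neighbourhood -/
lemma conf_flat (V : Opens (Pt n)) (g : Pt n → Mat n)
    (hsm : ∀ a b, ContDiffOn ℝ (⊤ : ℕ∞) (fun q => g q a b) V)
    (hsymm : ∀ q ∈ V, (g q)ᵀ = g q) (hdet : ∀ q ∈ V, (g q).det ≠ 0)
    (σ : Pt n → ℝ) (hσ : ContDiffOn ℝ (⊤ : ℕ∞) σ V)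
    (hflat : FlatOn (fun q => Real.exp (2 * σ q) • g q) V) :
    ∃ gR GR B : Matrix (Fin n) (Fin n) (FV V), (∀ q : V, g q = gR.map (ev V q)) ∧
      gR * GR = 1 ∧ gRᵀ = gR ∧ Bᵀ = B ∧
      (∀ i j, riem (DV V) (chris (DV V) (halfF V) gR GR) i j = KN gR GR B i j) ∧
      (∀ i j, dv (DV V) i (B j) - (chris (DV V) (halfF V) gR GR i)ᵀ *ᵥ B j =
        dv (DV V) j (B i) - (chris (DV V) (halfF V) gR GR j)ᵀ *ᵥ B i) := by
  let gR : Matrix (Fin n) (Fin n) (FV V) := Matrix.of fun a b => mkF V _ (hsm a b)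
  have hgR : ∀ q : V, g q = gR.map (ev V q) := fun q => by ext a b; rfl
  have hdR : IsUnit gR.det := isUnit_FV V _ fun q => by
    have := hdet q q.2
    rw [hgR] at this
    rw [RingHom.map_det]
    exact this
  have hgG : gR * gR⁻¹ = 1 := Matrix.mul_nonsing_inv _ hdR
  have hg : gRᵀ = gR := by
    refine Matrix.ext fun a b => ?_
    refine FV_ext V fun q => ?_
    exact congrFun (congrFun (hsymm q q.2) a) b
  let Γ := chris (DV V) (halfF V) gR gR⁻¹
  let σR := mkF V σ hσ
  let s : Fin n → FV V := fun i => DV V i σR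
  have hs : ∀ i j, DV V i (s j) = DV V j (s i) := fun i j => DV_comm V i j σR
  have h2 := half_add V
  have hc : ∀ i, dM (DV V) i gR = gR * Γ i + (Γ i)ᵀ * gR :=
    chris_compat (DV V) (halfF V) h2 gR gR⁻¹ hgG hg
  have ht : ∀ i l j, Γ i l j = Γ j l i := chris_torsion (DV V) (halfF V) gR gR⁻¹ hg
  have hσ2 : ContDiffOn ℝ (⊤ : ℕ∞) (fun q => Real.exp (2 * σ q)) V :=
    (contDiffOn_const.mul hσ).exp
  have hσ3 : ContDiffOn ℝ (⊤ : ℕ∞) (fun q => Real.exp (-(2 * σ q))) V :=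
    (contDiffOn_const.mul hσ).neg.exp
  let u := mkF V _ hσ2
  let ui := mkF V _ hσ3
  have hu : u * ui = 1 := FV_ext V fun q => by
    rw [map_mul, map_one]
    change Real.exp (2 * σ q) * Real.exp (-(2 * σ q)) = 1
    rw [← Real.exp_add]; simp
  have hdu : ∀ i, DV V i u = (2 * s i) * u := fun i => FV_ext V fun q => by
    have e1 : ev V q (DV V i u) = pd i (fun q => Real.exp (2 * σ q)) q :=
      (pd_eq V i _ u (fun _ => rfl) q).symm
    have e2 : ev V q (s i) = pd i σ q := (pd_eq V i _ σR (fun _ => rfl) q).symm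
    have e3 : ev V q u = Real.exp (2 * σ q) := rfl
    have hd : DifferentiableAt ℝ σ q :=
      (hσ.contDiffAt (V.isOpen.mem_nhds q.2)).differentiableAt (by simp)
    rw [map_mul, map_mul, e1, e2, e3, pd, fderiv_exp (hd.const_mul 2), fderiv_const_mul hd]
    have e4 : ev V q 2 = 2 := map_ofNat _ 2
    rw [e4]
    simp [pd]
    ring
  have hch : chris (DV V) (halfF V) (u • gR) (ui • gR⁻¹) = fun i => Γ i + Tt gR gR⁻¹ s i :=
    funext fun i => conf_chris (DV V) (halfF V) gR gR⁻¹ Γ s u ui hu hdu i h2 hgG hg hc ht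
  have hugG : (u • gR) * (ui • gR⁻¹) = 1 := by
    rw [Matrix.smul_mul, Matrix.mul_smul, smul_smul, hu, hgG, one_smul]
  have hR : ∀ i j, riem (DV V) Γ i j =
      KN gR gR⁻¹ (Bb (DV V) (halfF V) gR gR⁻¹ Γ s) i j := by
    intro i j
    have h0 : riem (DV V) (chris (DV V) (halfF V) (u • gR) (ui • gR⁻¹)) i j = 0 := by
      refine Matrix.ext fun l k => ?_
      refine FV_ext V fun q => ?_
      rw [← riemann_eq V (fun q => Real.exp (2 * σ q) • g q) _ _ ?_ hugG, hflat q q.2]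
      · simp
      · intro q
        ext a b
        simp only [hgR q]
        simp [ev_apply, u, mkF]
    rw [hch, riem_conf (DV V) (halfF V) h2 gR gR⁻¹ hgG hg Γ hc ht s hs] at h0
    exact sub_eq_zero.mp h0
  refine ⟨gR, gR⁻¹, Bb (DV V) (halfF V) gR gR⁻¹ Γ s, hgR, hgG, hg, ?_, hR, ?_⟩
  · refine Matrix.ext fun a b => ?_
    exact Bb_symm (DV V) (halfF V) gR gR⁻¹ hg Γ ht s hs b a
  · exact codazzi (DV V) (halfF V) h2 gR gR⁻¹ hgG hg Γ hc ht s hs (DV_comm V) hR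

lemma schouten_eval (hn : 3 ≤ n) (V : Opens (Pt n)) (g : Pt n → Mat n)
    (gR GR B : Matrix (Fin n) (Fin n) (FV V)) (hgR : ∀ q : V, g q = gR.map (ev V q))
    (hgG : gR * GR = 1) (hg : gRᵀ = gR) (hB : Bᵀ = B)
    (hR : ∀ i j, riem (DV V) (chris (DV V) (halfF V) gR GR) i j = KN gR GR B i j) (q : V) :
    schouten g q = B.map (ev V q) := by
  have hinv : (g q)⁻¹ = GR.map (ev V q) := by rw [hgR]; exact ev_inv V q gR GR hgG
  refine schouten_of_KN hn g q _ ?_ ?_ ?_ ?_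
  · rw [hgR, ← Matrix.transpose_map, hg]
  · rw [← Matrix.transpose_map, hB]
  · rw [hgR]
    refine Matrix.isUnit_det_of_right_inverse (B := GR.map (ev V q)) ?_
    rw [← Matrix.map_mul, hgG]; simp
  · intro l i j k
    rw [riemann_eq V g gR GR hgR hgG, hR, KN_map, hinv, hgR]

end Conc

lemma eig_inv {n : ℕ} (M N : Loc.Mat n) (h : M * N = 1) (μ : ℝ) :
    IsEigenvalue N μ ↔ ∃ lam : ℝ, IsEigenvalue M lam ∧ μ = lam⁻¹ := by
  have key : ∀ (M N : Loc.Mat n) (_ : M * N = 1) (μ : ℝ), IsEigenvalue N μ →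
      IsEigenvalue M μ⁻¹ := by
    rintro M N h μ ⟨v, hv, e⟩
    refine ⟨v, hv, ?_⟩
    have h1 : v = μ • (M *ᵥ v) := by
      rw [← Matrix.mulVec_smul, ← e, Matrix.mulVec_mulVec, h, Matrix.one_mulVec]
    have hμ : μ ≠ 0 := by
      rintro rfl
      rw [zero_smul] at h1
      exact hv h1
    conv_rhs => rw [h1]
    rw [smul_smul, inv_mul_cancel₀ hμ, one_smul]
  constructor
  · intro hN
    exact ⟨μ⁻¹, key M N h μ hN, (inv_inv μ).symm⟩
  · rintro ⟨lam, hl, rfl⟩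
    exact key N M (mul_eq_one_comm.mp h) lam hl

end GCFAux

/-- Corollary, Espinar–Gálvez–Mira: for a GCF-manifold with induced metric
`g` and dual metric `ǧ = Σ A_{ia} A_{jb} g^{ab} du^i ⊗ du^j` on `R*`, the eigenvalues of
the Schouten tensor of `ǧ` with respect to `ǧ` (i.e. of the endomorphism `ǧ⁻¹ Ǎ`) are
exactly the inverses of the eigenvalues of the Schouten tensor `A` of `g` with respect
to `g` (i.e. of `g⁻¹ A`). -/
theorem statement1 {n : ℕ} (d : Loc.CTB n) (hgcf : d.IsGCF) :
    ∀ p ∈ d.regStar, ∀ μ : ℝ,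
      IsEigenvalue ((d.dualMet p)⁻¹ * schouten d.dualMet p) μ ↔
        ∃ lam : ℝ, IsEigenvalue ((d.gmet p)⁻¹ * d.schoutenT p) lam ∧ μ = lam⁻¹ := by
  classical
  intro p hp μ
  obtain ⟨hn, hctb, -, hcf⟩ := hgcf
  obtain ⟨hU, hh, hhs, -, -, hφ, -⟩ := hctb
  obtain ⟨V, hV, hpV, hVs, σ, hσ, hflat⟩ := hcf p hp.1
  -- the induced metric
  have hsm : ∀ a b, ContDiffOn ℝ (⊤ : ℕ∞) (fun q => d.gmet q a b) V := by
    intro a b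
    have hVU : V ⊆ d.U := fun q hq => (hVs hq).1
    simp only [Loc.CTB.gmet, Matrix.mul_apply, Matrix.transpose_apply]
    refine ContDiffOn.sum fun i _ => ContDiffOn.mul (ContDiffOn.sum fun j _ => ?_) ?_
    · exact ((hφ j a).mono hVU).mul ((hh j i).mono hVU)
    · exact (hφ i b).mono hVU
  have hsymm : ∀ q ∈ V, Matrix.transpose (d.gmet q) = d.gmet q := by
    intro q hq
    have : Matrix.transpose (d.h q) = d.h q := (hhs q (hVs hq).1).1
    simp only [Loc.CTB.gmet, Matrix.transpose_mul, Matrix.transpose_transpose, this, mul_assoc]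
  have hdet : ∀ q ∈ V, (d.gmet q).det ≠ 0 := by
    intro q hq
    have h1 := (hhs q (hVs hq).1).2.det_pos
    have h2 := (hVs hq).2
    simp only [Loc.CTB.gmet, Matrix.det_mul, Matrix.det_transpose]
    exact mul_ne_zero (mul_ne_zero h2 h1.ne') h2
  let V₁ : TopologicalSpace.Opens (Loc.Pt n) := ⟨V, hV⟩
  -- shrink to the set where the Schouten tensor is invertible
  obtain ⟨V₂, hpV₂, hV₂, hA⟩ : ∃ V₂ : TopologicalSpace.Opens (Loc.Pt n), p ∈ V₂ ∧
      (V₂ : Set (Loc.Pt n)) ⊆ V ∧ ∀ q ∈ V₂, (schouten d.gmet q).det ≠ 0 := by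
    obtain ⟨gR, GR, B, hgR, hgG, hg, hB, hR, -⟩ :=
      GCFAux.conf_flat V₁ d.gmet hsm hsymm hdet σ hσ hflat
    have hs := GCFAux.schouten_eval hn V₁ d.gmet gR GR B hgR hgG hg hB hR
    have hc : ContinuousOn (GCFAux.ext V₁ B.det.1) V := B.det.2.continuousOn
    have he : ∀ q, q ∈ V → (schouten d.gmet q).det = GCFAux.ext V₁ B.det.1 q := by
      intro q hq
      rw [GCFAux.ext_apply V₁ _ ⟨q, hq⟩, hs ⟨q, hq⟩, ← GCFAux.ev_apply, RingHom.map_det]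
      rfl
    refine ⟨⟨V ∩ Set.preimage (GCFAux.ext V₁ B.det.1) {0}ᶜ,
      hc.isOpen_inter_preimage hV isOpen_compl_singleton⟩, ⟨hpV, ?_⟩, Set.inter_subset_left, ?_⟩
    · have := hp.2
      rw [Loc.CTB.schoutenT, he p hpV] at this
      exact this
    · rintro q ⟨hq, hq2⟩
      rw [he q hq]
      exact hq2
  obtain ⟨gR, GR, B, hgR, hgG, hg, hB, hR, hcod⟩ :=
    GCFAux.conf_flat V₂ d.gmet (fun a b => (hsm a b).mono hV₂) (fun q hq => hsymm q (hV₂ hq))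
      (fun q hq => hdet q (hV₂ hq)) σ (hσ.mono hV₂) (fun q hq => hflat q (hV₂ hq))
  have hs := GCFAux.schouten_eval hn V₂ d.gmet gR GR B hgR hgG hg hB hR
  have hBu : IsUnit B.det := GCFAux.isUnit_FV V₂ _ fun q => by
    have := hA q q.2
    rw [hs q] at this
    rw [RingHom.map_det]
    exact this
  have hBB : B * B⁻¹ = 1 := Matrix.mul_nonsing_inv _ hBu
  have hBB' : B⁻¹ * B = 1 := Matrix.nonsing_inv_mul _ hBu
  have hGg : GR * gR = 1 := mul_eq_one_comm.mp hgG
  have hGs := GCFAux.G_symm gR GR hgG hg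
  have hdR := GCFAux.dual_riem (GCFAux.DV V₂) (GCFAux.halfF V₂) gR GR _ (GCFAux.DV_comm V₂) B B⁻¹
    hB hBB (GCFAux.half_add V₂) hgG hg
    (GCFAux.chris_compat _ _ (GCFAux.half_add V₂) gR GR hgG hg) hcod hR
  have hdual : ∀ q : V₂, d.dualMet q = (B * GR * B).map (GCFAux.ev V₂ q) := by
    intro q
    have hinv : (d.gmet q)⁻¹ = GR.map (GCFAux.ev V₂ q) := by
      rw [hgR]; exact GCFAux.ev_inv V₂ q gR GR hgG
    rw [Loc.CTB.dualMet, Loc.CTB.schoutenT, hs q, hinv, Matrix.map_mul, Matrix.map_mul]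
  have hdG : (B * GR * B) * (B⁻¹ * gR * B⁻¹) = 1 := by
    calc (B * GR * B) * (B⁻¹ * gR * B⁻¹) = B * (GR * ((B * B⁻¹) * gR)) * B⁻¹ := by
          simp only [mul_assoc]
      _ = 1 := by rw [hBB, one_mul, hGg, mul_one, hBB]
  have hds := GCFAux.schouten_eval hn V₂ d.dualMet (B * GR * B) (B⁻¹ * gR * B⁻¹) B hdual hdG
    (by simp only [Matrix.transpose_mul, hB, hGs, mul_assoc]) hB hdR
  have f1 := hds ⟨p, hpV₂⟩
  have f2 := hs ⟨p, hpV₂⟩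
  have f3 : (d.gmet p)⁻¹ = GR.map (GCFAux.ev V₂ ⟨p, hpV₂⟩) := by
    rw [hgR ⟨p, hpV₂⟩]; exact GCFAux.ev_inv V₂ _ gR GR hgG
  have f4 : (d.dualMet p)⁻¹ = (B⁻¹ * gR * B⁻¹).map (GCFAux.ev V₂ ⟨p, hpV₂⟩) := by
    rw [hdual ⟨p, hpV₂⟩]; exact GCFAux.ev_inv V₂ _ _ _ hdG
  dsimp only at f1 f2
  rw [Loc.CTB.schoutenT, f1, f2, f3, f4]
  apply GCFAux.eig_inv
  rw [← Matrix.map_mul, ← Matrix.map_mul, ← Matrix.map_mul]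
  have : GR * B * (B⁻¹ * gR * B⁻¹ * B) = 1 := by
    calc GR * B * (B⁻¹ * gR * B⁻¹ * B) = GR * ((B * B⁻¹) * gR) * (B⁻¹ * B) := by
          simp only [mul_assoc]
      _ = 1 := by rw [hBB, hBB', one_mul, hGg, mul_one]
  rw [this]
  simp
end
end
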